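/- arXiv:1011.2081 — 7 statements merged into one kernel-verified Lean document; each statement's English description precedes it below -/
import Mathlib

section
/- Let M be a Nevanlinna function, not identically zero, which extends holomorphically to (ℂ∖ℝ) ∪ (α−γ, α) for some α ∈ ℝ and γ > 0, and let L = lim_{x↑α} M(x) ∈ (−∞, +∞] (this limit exists since M is increasing on (α−γ, α)). Let β ∈ ℂ⁺ ∪ ℝ with β ≠ α, and let Q(z) = (z−α)²·M(z) or Q(z) = (z−α)²·M(z)/((z−β)(z−conj β)). Then: there exists ε > 0 such that Q′(x) < 0 for all x ∈ (α−ε, α) if and only if L ∈ (0, +∞]; and there exists ε > 0 such that Q′(x) > 0 for all x ∈ (α−ε, α) if and only if L ≤ 0. -/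
open Complex Filter Set

/-- The Schwarz–Pick inequality for holomorphic self-maps of the upper half-plane. -/
lemma schwarzPick_of_im_pos {f : ℂ → ℂ} (hf : DifferentiableOn ℂ f {z | 0 < z.im})
    (him : ∀ z : ℂ, 0 < z.im → 0 < (f z).im) {z w : ℂ} (hz : 0 < z.im) (hw : 0 < w.im) :
    z.im * w.im * normSq (f z - f w) ≤ (f z).im * (f w).im * normSq (z - w) := by
  have key : ∀ u v : ℂ, normSq (u - (starRingEnd ℂ) v) = normSq (u - v) + 4 * (u.im * v.im) := by
    intro u v
    simp only [normSq_apply, sub_re, sub_im, conj_re, conj_im]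
    ring
  have pos : ∀ u v : ℂ, 0 < u.im → 0 < v.im → 0 < normSq (u - (starRingEnd ℂ) v) := by
    intro u v hu hv
    rw [key]
    have := normSq_nonneg (u - v)
    positivity
  have ne : ∀ u v : ℂ, 0 < u.im → 0 < v.im → u - (starRingEnd ℂ) v ≠ 0 :=
    fun u v hu hv => normSq_pos.1 (pos u v hu hv)
  set h : ℂ → ℂ := fun ζ => (w - (starRingEnd ℂ) w * ζ) / (1 - ζ) with hh
  have one_sub_ne : ∀ ζ ∈ Metric.ball (0 : ℂ) 1, 1 - ζ ≠ 0 := by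
    intro ζ hζ h0
    rw [← sub_eq_zero.1 h0] at hζ
    simp at hζ
  have h_im : ∀ ζ ∈ Metric.ball (0 : ℂ) 1, 0 < (h ζ).im := by
    intro ζ hζ
    have hn := normSq_pos.2 (one_sub_ne ζ hζ)
    have hζ' : normSq ζ < 1 := by
      rw [mem_ball_zero_iff] at hζ
      rw [normSq_eq_norm_sq]
      nlinarith [norm_nonneg ζ]
    have : (h ζ).im = w.im * (1 - normSq ζ) / normSq (1 - ζ) := by
      simp only [hh, div_im, normSq_apply, sub_re, sub_im, mul_re, mul_im, conj_re, conj_im,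
        one_re, one_im]
      ring
    rw [this]
    have := sub_pos.2 hζ'
    positivity
  set g : ℂ → ℂ := fun ζ => (f (h ζ) - f w) / (f (h ζ) - (starRingEnd ℂ) (f w)) with hg
  have hd : DifferentiableOn ℂ h (Metric.ball 0 1) := by
    refine DifferentiableOn.div (by fun_prop) (by fun_prop) one_sub_ne
  have hfd : DifferentiableOn ℂ (fun ζ => f (h ζ)) (Metric.ball 0 1) := hf.comp hd h_im
  have hgd : DifferentiableOn ℂ g (Metric.ball 0 1) :=
    (hfd.sub_const _).div (hfd.sub_const _) fun ζ hζ =>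
      ne _ _ (him _ (h_im ζ hζ)) (him _ hw)
  have hmaps : MapsTo g (Metric.ball 0 1) (Metric.closedBall 0 1) := by
    intro ζ hζ
    have hp := him _ (h_im ζ hζ)
    rw [mem_closedBall_zero_iff, norm_div, div_le_one (norm_pos_iff.2 (ne _ _ hp (him _ hw))),
      ← abs_norm, ← abs_norm (_ - (starRingEnd ℂ) _), ← sq_le_sq, ← normSq_eq_norm_sq,
      ← normSq_eq_norm_sq, key]
    have := mul_pos hp (him _ hw)
    linarith
  have hg0 : g 0 = 0 := by simp [hg, hh]
  set ζ := (z - w) / (z - (starRingEnd ℂ) w) with hζ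
  have hzw := ne z w hz hw
  have hhζ : h ζ = z := by
    have hne : w - (starRingEnd ℂ) w ≠ 0 := ne w w hw hw
    have h1 : 1 - ζ = (w - (starRingEnd ℂ) w) / (z - (starRingEnd ℂ) w) := by
      rw [hζ]; field_simp; ring
    simp only [hh]
    rw [h1, hζ]
    field_simp
    ring
  have hζn : ‖ζ‖ < 1 := by
    rw [norm_div, div_lt_one (norm_pos_iff.2 hzw), ← abs_norm,
      ← abs_norm (_ - (starRingEnd ℂ) _), ← sq_lt_sq, ← normSq_eq_norm_sq,
      ← normSq_eq_norm_sq, key]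
    have := mul_pos hz hw
    linarith
  have main := norm_le_norm_of_mapsTo_ball hgd hmaps hg0 hζn
  have hfz := him z hz
  have hfw := him w hw
  simp only [hg, hhζ] at main
  replace main := pow_le_pow_left₀ (norm_nonneg _) main 2
  rw [hζ, ← normSq_eq_norm_sq, ← normSq_eq_norm_sq, normSq_div, normSq_div, div_le_div_iff₀ (pos _ _ hfz hfw)
      (pos _ _ hz hw), key, key] at main
  linarith

lemma schwarzPick_of_im_nonneg {f : ℂ → ℂ} (hf : DifferentiableOn ℂ f {z | 0 < z.im})
    (him : ∀ z : ℂ, 0 < z.im → 0 ≤ (f z).im) {z w : ℂ} (hz : 0 < z.im) (hw : 0 < w.im) :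
    z.im * w.im * normSq (f z - f w) ≤ (f z).im * (f w).im * normSq (z - w) := by
  have hlim : Tendsto (fun δ : ℝ => ((f z).im + δ) * ((f w).im + δ) * normSq (z - w))
      (nhdsWithin 0 (Ioi 0)) (nhds (((f z).im + 0) * ((f w).im + 0) * normSq (z - w))) := by
    refine Tendsto.mono_left (Continuous.tendsto ?_ 0) nhdsWithin_le_nhds
    fun_prop
  rw [add_zero, add_zero] at hlim
  refine ge_of_tendsto hlim ?_
  filter_upwards [self_mem_nhdsWithin] with δ hδ
  have hδ : 0 < δ := hδ
  have := schwarzPick_of_im_pos (f := fun z => f z + δ * I) (hf.add_const _)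
    (fun z hz => by simpa using add_pos_of_nonneg_of_pos (him z hz) hδ) hz hw
  simpa using this

lemma tendsto_im_div_of_hasDerivAt {f : ℂ → ℂ} {a : ℂ} {x : ℝ} (hf : HasDerivAt f a x)
    (hx : (f x).im = 0) :
    Tendsto (fun t : ℝ => (f (x + t * I)).im / t) (nhdsWithin 0 (Ioi 0)) (nhds a.re) := by
  have h1 : HasDerivAt (fun t : ℂ => (x : ℂ) + t * I) I ((0 : ℝ) : ℂ) := by
    simpa using ((hasDerivAt_id ((0 : ℝ) : ℂ)).mul_const I).const_add (x : ℂ)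
  have h2 : HasDerivAt (fun t : ℂ => -I * f (x + t * I)) (-I * (a * I)) ((0 : ℝ) : ℂ) := by
    refine HasDerivAt.const_mul _ (HasDerivAt.comp _ ?_ h1)
    simpa using hf
  have h3 := h2.real_of_complex
  have e : -I * (a * I) = a := by linear_combination (-a) * I_mul_I
  rw [e, hasDerivAt_iff_tendsto_slope] at h3
  refine (h3.mono_left (nhdsWithin_mono _ fun t (ht : 0 < t) => ht.ne')).congr fun t => ?_
  simp [slope_def_field, hx]

/-- The two-point Loewner inequality for boundary values of a Nevanlinna function. -/
lemma loewner_inequality {f : ℂ → ℂ} (hf : DifferentiableOn ℂ f {z | 0 < z.im})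
    (him : ∀ z : ℂ, 0 < z.im → 0 ≤ (f z).im) {x y : ℝ} {a b : ℂ}
    (hx : HasDerivAt f a x) (hy : HasDerivAt f b y) (hx0 : (f x).im = 0) (hy0 : (f y).im = 0) :
    ((f x).re - (f y).re) ^ 2 ≤ a.re * b.re * (x - y) ^ 2 := by
  have hc : ∀ {u : ℝ} {c : ℂ}, HasDerivAt f c u →
      Tendsto (fun t : ℝ => f (u + t * I)) (nhdsWithin 0 (Ioi 0)) (nhds (f u)) := by
    intro u c hu
    refine hu.continuousAt.tendsto.comp (Tendsto.mono_left ?_ nhdsWithin_le_nhds)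
    have : Continuous (fun t : ℝ => (u : ℂ) + t * I) := by fun_prop
    simpa using this.tendsto 0
  have hl := (continuous_normSq.tendsto _).comp ((hc hx).sub (hc hy))
  have hr := ((tendsto_im_div_of_hasDerivAt hx hx0).mul
    (tendsto_im_div_of_hasDerivAt hy hy0)).mul_const ((x - y) ^ 2)
  have hle : normSq (f x - f y) ≤ a.re * b.re * (x - y) ^ 2 := by
    refine le_of_tendsto_of_tendsto hl hr ?_
    filter_upwards [self_mem_nhdsWithin] with t ht
    have ht : 0 < t := ht
    have := schwarzPick_of_im_nonneg hf him (z := x + t * I) (w := y + t * I)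
      (by simpa using ht) (by simpa using ht)
    have e : normSq ((x : ℂ) + t * I - (y + t * I)) = (x - y) ^ 2 := by
      simp [normSq_apply]; ring
    rw [e] at this
    simp only [add_im, ofReal_im, mul_im, ofReal_re, I_im, I_re, mul_one, mul_zero, zero_add,
      add_zero] at this
    rw [Function.comp_apply, div_mul_div_comm, div_mul_eq_mul_div, le_div_iff₀ (by positivity)]
    linarith
  refine le_trans (le_of_eq ?_) hle
  simp [normSq_apply, hx0, hy0, sq]

lemma AnalyticAt.dslope_self {m : ℝ → ℝ} {x : ℝ} (h : AnalyticAt ℝ m x) :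
    AnalyticAt ℝ (dslope m x) x := by
  obtain ⟨p, hp⟩ := h
  exact ⟨_, hp.has_fpower_series_dslope_fslope⟩

/-- The difference between the reciprocals of an increment of `m` and of its linear part has a
limit at the base point. -/
lemma exists_tendsto_inv_sub_inv {m : ℝ → ℝ} {x d : ℝ} (h : AnalyticAt ℝ m x)
    (hd : HasDerivAt m d x) (hd0 : d ≠ 0) :
    ∃ c, Tendsto (fun y => (m x - m y)⁻¹ - (d * (x - y))⁻¹) (nhdsWithin x {x}ᶜ) (nhds c) := by
  set g := dslope m x with hg
  set k := dslope g x with hk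
  have hgx : g x = d := by rw [hg, dslope_same, hd.deriv]
  have hgc : ContinuousAt g x := h.dslope_self.continuousAt
  have hkc : ContinuousAt k x := h.dslope_self.dslope_self.continuousAt
  have hlim : Tendsto (fun y => k y / (g y * d)) (nhdsWithin x {x}ᶜ) (nhds (k x / (g x * d))) :=
    (hkc.div (hgc.mul_const d) (by rw [hgx]; exact mul_ne_zero hd0 hd0)).tendsto.mono_left
      nhdsWithin_le_nhds
  refine ⟨_, hlim.congr' ?_⟩
  have hne : ∀ᶠ y in nhdsWithin x {x}ᶜ, g y ≠ 0 :=
    (hgc.eventually_ne (by rwa [hgx])).filter_mono nhdsWithin_le_nhds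
  filter_upwards [hne, self_mem_nhdsWithin] with y hy hyx
  have hyx : y ≠ x := hyx
  have h1 : m x - m y = (x - y) * g y := by
    have := sub_smul_dslope m x y
    rw [smul_eq_mul] at this
    linear_combination this
  have h2 : (y - x) * k y = g y - d := by
    have := sub_smul_dslope g x y
    rwa [smul_eq_mul, hgx] at this
  have hxy : x - y ≠ 0 := sub_ne_zero.2 hyx.symm
  rw [h1]
  field_simp
  linear_combination -h2

section RealLoewner

variable {m m' : ℝ → ℝ} {a b : ℝ}

lemma monotoneOn_Ioo_of_hasDerivAt_nonneg (hder : ∀ x ∈ Ioo a b, HasDerivAt m (m' x) x)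
    (hnn : ∀ x ∈ Ioo a b, 0 ≤ m' x) : MonotoneOn m (Ioo a b) := by
  refine monotoneOn_of_deriv_nonneg (convex_Ioo a b)
    (fun y hy => (hder y hy).continuousAt.continuousWithinAt) ?_ ?_
  · exact fun y hy => (hder y (interior_subset hy)).differentiableAt.differentiableWithinAt
  · intro y hy
    have hy := interior_subset hy
    rw [(hder y hy).deriv]
    exact hnn y hy

lemma monotoneOn_inv_sub_inv {s : Set ℝ} {x : ℝ} (hs : Convex ℝ s) (hso : IsOpen s) (hxs : x ∉ s)
    (hder : ∀ y ∈ s, HasDerivAt m (m' y) y) (hx : 0 < m' x) (hne : ∀ y ∈ s, m x ≠ m y)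
    (hlo : ∀ y ∈ s, (m x - m y) ^ 2 ≤ m' x * m' y * (x - y) ^ 2) :
    MonotoneOn (fun y => (m x - m y)⁻¹ - (m' x * (x - y))⁻¹) s := by
  have hd : ∀ y ∈ s, HasDerivAt (fun y => (m x - m y)⁻¹ - (m' x * (x - y))⁻¹)
      (m' y / (m x - m y) ^ 2 - m' x / (m' x * (x - y)) ^ 2) y := by
    intro y hy
    have hxy : x - y ≠ 0 := sub_ne_zero.2 fun h => hxs (h ▸ hy)
    have h1 := ((hder y hy).const_sub (m x)).inv (sub_ne_zero.2 (hne y hy))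
    have h2 := (((hasDerivAt_id y).const_sub x).const_mul (m' x)).inv
      (mul_ne_zero hx.ne' hxy)
    exact (h1.sub h2).congr_deriv (by simp)
  refine monotoneOn_of_deriv_nonneg hs (fun y hy => (hd y hy).continuousAt.continuousWithinAt)
    (fun y hy => (hd y (interior_subset hy)).differentiableAt.differentiableWithinAt) ?_
  intro y hy
  rw [hso.interior_eq] at hy
  have hxy : x - y ≠ 0 := sub_ne_zero.2 fun h => hxs (h ▸ hy)
  have hm := sub_ne_zero.2 (hne y hy)
  have h1 : 0 < (m x - m y) ^ 2 := by positivity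
  have h2 : 0 < (m' x * (x - y)) ^ 2 := by have := hx.ne'; positivity
  rw [(hd y hy).deriv, sub_nonneg, div_le_div_iff₀ h2 h1]
  nlinarith [mul_le_mul_of_nonneg_left (hlo y hy) hx.le]

/-- The Loewner inequality on `(a, b)` bounds the derivative by the increments to the left, as if
`m` were concave in the variable `1 / (b - x)`. -/
lemma deriv_mul_le_of_loewner (han : ∀ x ∈ Ioo a b, AnalyticAt ℝ m x)
    (hder : ∀ x ∈ Ioo a b, HasDerivAt m (m' x) x) (hnn : ∀ x ∈ Ioo a b, 0 ≤ m' x)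
    (hlo : ∀ x ∈ Ioo a b, ∀ y ∈ Ioo a b, (m x - m y) ^ 2 ≤ m' x * m' y * (x - y) ^ 2)
    {x₀ x : ℝ} (hx₀ : a < x₀) (hx₀x : x₀ < x) (hxb : x < b) :
    m' x * ((b - x) * (x - x₀)) ≤ (m x - m x₀) * (b - x₀) := by
  have hx : x ∈ Ioo a b := ⟨hx₀.trans hx₀x, hxb⟩
  have hx₀' : x₀ ∈ Ioo a b := ⟨hx₀, hx₀x.trans hxb⟩
  have hmono : MonotoneOn m (Ioo a b) := monotoneOn_Ioo_of_hasDerivAt_nonneg hder hnn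
  rcases (hnn x hx).eq_or_lt with h0 | hpos
  · rw [← h0, zero_mul]
    exact mul_nonneg (sub_nonneg.2 (hmono hx₀' hx hx₀x.le)) (by linarith)
  have hpos' : ∀ y ∈ Ioo a b, 0 < m' y := by
    intro y hy
    refine (hnn y hy).lt_of_ne fun h0 => ?_
    have hconst : ∀ u ∈ Ioo a b, m u = m y := by
      intro u hu
      have := hlo u hu y hy
      rw [← h0, mul_zero, zero_mul] at this
      exact sub_eq_zero.1 (pow_eq_zero_iff two_ne_zero |>.1 (le_antisymm this (sq_nonneg _)))
    have : HasDerivAt m 0 x := (hasDerivAt_const x (m y)).congr_of_eventuallyEq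
      (eventually_of_mem (Ioo_mem_nhds hx.1 hx.2) hconst)
    exact hpos.ne' ((hder x hx).unique this)
  have hstrict : StrictMonoOn m (Ioo a b) := by
    refine strictMonoOn_of_deriv_pos (convex_Ioo a b)
      (fun y hy => (hder y hy).continuousAt.continuousWithinAt) fun y hy => ?_
    have hy := interior_subset hy
    rw [(hder y hy).deriv]
    exact hpos' y hy
  obtain ⟨c, hc⟩ := exists_tendsto_inv_sub_inv (han x hx) (hder x hx) hpos.ne'
  have hsubl : Ioo a x ⊆ Ioo a b := Ioo_subset_Ioo_right hxb.le
  have hsubr : Ioo x b ⊆ Ioo a b := Ioo_subset_Ioo_left hx.1.le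
  have hl := monotoneOn_inv_sub_inv (m := m) (m' := m') (convex_Ioo a x) isOpen_Ioo (by simp)
    (fun y hy => hder y (hsubl hy)) hpos (fun y hy => (hstrict (hsubl hy) hx hy.2).ne')
    (fun y hy => hlo x hx y (hsubl hy))
  have hr := monotoneOn_inv_sub_inv (m := m) (m' := m') (convex_Ioo x b) isOpen_Ioo (by simp)
    (fun y hy => hder y (hsubr hy)) hpos (fun y hy => (hstrict hx (hsubr hy) hy.1).ne)
    (fun y hy => hlo x hx y (hsubr hy))
  have hle_c : (m x - m x₀)⁻¹ - (m' x * (x - x₀))⁻¹ ≤ c := by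
    refine ge_of_tendsto (hc.mono_left (nhdsWithin_mono x (s := Iio x) fun y hy => ne_of_lt hy)) ?_
    filter_upwards [Ioo_mem_nhdsLT hx₀x] with y hy
    exact hl ⟨hx₀, hx₀x⟩ ⟨hx₀.trans hy.1, hy.2⟩ hy.1.le
  have hc_le : ∀ y ∈ Ioo x b, c ≤ (m' x * (y - x))⁻¹ := by
    intro y hy
    have h1 : c ≤ (m x - m y)⁻¹ - (m' x * (x - y))⁻¹ := by
      refine le_of_tendsto (hc.mono_left (nhdsWithin_mono x (s := Ioi x) fun u hu => ne_of_gt hu)) ?_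
      filter_upwards [Ioo_mem_nhdsGT hy.1] with u hu
      exact hr ⟨hu.1, hu.2.trans hy.2⟩ hy hu.2.le
    have h2 : (m x - m y)⁻¹ ≤ 0 := inv_nonpos.2 (sub_nonpos.2 (hmono hx (hsubr hy) hy.1.le))
    have h3 : (m' x * (y - x))⁻¹ = -(m' x * (x - y))⁻¹ := by
      rw [← inv_neg]; ring_nf
    linarith
  have hxb' : 0 < b - x := sub_pos.2 hxb
  have hxx : 0 < x - x₀ := sub_pos.2 hx₀x
  have hmm : 0 < m x - m x₀ := sub_pos.2 (hstrict hx₀' hx hx₀x)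
  have hc_le_b : c ≤ (m' x * (b - x))⁻¹ := by
    have : ContinuousAt (fun y => (m' x * (y - x))⁻¹) b :=
      ContinuousAt.inv₀ (by fun_prop) (mul_pos hpos hxb').ne'
    refine ge_of_tendsto (this.tendsto.mono_left (nhdsWithin_le_nhds (s := Iio b))) ?_
    filter_upwards [Ioo_mem_nhdsLT hxb] with y hy using hc_le y hy
  have hfin : (m x - m x₀)⁻¹ ≤ (b - x₀) / (m' x * ((b - x) * (x - x₀))) := by
    have e : (b - x₀) / (m' x * ((b - x) * (x - x₀)))
        = (m' x * (b - x))⁻¹ + (m' x * (x - x₀))⁻¹ := by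
      field_simp
      ring
    linarith
  rw [inv_eq_one_div, div_le_div_iff₀ hmm (by positivity)] at hfin
  linarith

end RealLoewner

section WeightedSquare

variable {m m' w w' : ℝ → ℝ} {α : ℝ}

lemma eventually_abs_sub_mul_le (hw' : ContinuousAt w' α) (hw : ContinuousAt w α)
    (hwα : 0 < w α) :
    ∀ᶠ x in nhdsWithin α (Iio α), 0 < w x ∧ |(x - α) * w' x| ≤ w x / 4 := by
  refine Eventually.filter_mono nhdsWithin_le_nhds ?_
  have h1 : ContinuousAt (fun x => w x / 4 - |(x - α) * w' x|) α := by fun_prop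
  have h2 : ∀ᶠ x in nhds α, 0 < w x / 4 - |(x - α) * w' x| :=
    h1.eventually_const_lt (by simpa using hwα)
  filter_upwards [h2, hw.eventually_const_lt hwα] with x hx hx'
  exact ⟨hx', by linarith⟩

/-- The derivative of `(x - α)² m w`, when `m` and `w` have derivatives `m'` and `w'`, is positive
to the left of `α` if `m` is increasing and negative. -/
lemma eventually_deriv_sq_mul_pos
    (hw : ∀ᶠ x in nhdsWithin α (Iio α), 0 < w x ∧ |(x - α) * w' x| ≤ w x / 4)
    (hm : ∀ᶠ x in nhdsWithin α (Iio α), m x < 0 ∧ 0 ≤ m' x) :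
    ∀ᶠ x in nhdsWithin α (Iio α),
      0 < 2 * (x - α) * (m x * w x) + (x - α) ^ 2 * (m' x * w x + m x * w' x) := by
  filter_upwards [hw, hm, self_mem_nhdsWithin] with x ⟨hw0, hw1⟩ ⟨hm0, hm1⟩ hx
  have hx : 0 < α - x := sub_pos.2 hx
  have h1 := (abs_le.1 hw1).1
  have h2 : 0 < (α - x) * (-m x) * (2 * w x + (x - α) * w' x) :=
    mul_pos (mul_pos hx (by linarith)) (by linarith)
  have h3 : 0 ≤ (x - α) ^ 2 * (m' x * w x) := by positivity
  nlinarith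

lemma eventually_deriv_sq_mul_neg
    (hw : ∀ᶠ x in nhdsWithin α (Iio α), 0 < w x ∧ |(x - α) * w' x| ≤ w x / 4)
    (hm : ∀ᶠ x in nhdsWithin α (Iio α), 0 < m x ∧ (α - x) * m' x ≤ 3 / 2 * m x) :
    ∀ᶠ x in nhdsWithin α (Iio α),
      2 * (x - α) * (m x * w x) + (x - α) ^ 2 * (m' x * w x + m x * w' x) < 0 := by
  filter_upwards [hw, hm, self_mem_nhdsWithin] with x ⟨hw0, hw1⟩ ⟨hm0, hm1⟩ hx
  have hx : 0 < α - x := sub_pos.2 hx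
  have h1 := (abs_le.1 hw1).1
  have h2 := mul_le_mul_of_nonneg_left hm1 (mul_pos hx hw0).le
  have h3 : (α - x) * m x * (-((x - α) * w' x)) ≤ (α - x) * m x * (w x / 4) :=
    mul_le_mul_of_nonneg_left (by linarith) (by positivity)
  have h4 : 0 < (α - x) * m x * w x := by positivity
  nlinarith

end WeightedSquare

section SlitPlane

variable {M : ℂ → ℂ} {a b : ℝ}

lemma isOpen_slitPlane_Ioo (a b : ℝ) : IsOpen {z : ℂ | z.im ≠ 0 ∨ (a < z.re ∧ z.re < b)} :=
  (isOpen_ne_fun continuous_im continuous_const).union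
    ((isOpen_lt continuous_const continuous_re).inter (isOpen_lt continuous_re continuous_const))

lemma isPreconnected_slitPlane_Ioo {x : ℝ} (hx : x ∈ Ioo a b) :
    IsPreconnected {z : ℂ | z.im ≠ 0 ∨ (a < z.re ∧ z.re < b)} := by
  refine (StarConvex.isPathConnected (a := (x : ℂ)) ?_
    (Or.inr (by simpa using hx))).isConnected.isPreconnected
  intro z hz s t hs ht hst
  by_cases h : t * z.im = 0
  · refine Or.inr ?_
    have key : t = 0 ∨ z.re ∈ Ioo a b := by
      rcases mul_eq_zero.1 h with h | h
      · exact Or.inl h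
      · exact Or.inr (hz.resolve_left (not_not.2 h))
    rcases key with rfl | hzr
    · obtain rfl : s = 1 := by linarith
      simpa using hx
    · simpa using convex_Ioo a b hx hzr hs ht hst
  · exact Or.inl (by simpa using h)

lemma im_eq_zero_of_symm
    (hsymm : ∀ z : ℂ, z.im ≠ 0 → M ((starRingEnd ℂ) z) = (starRingEnd ℂ) (M z))
    {x : ℝ} (hM : ContinuousAt M x) : (M x).im = 0 := by
  have hlim : ∀ s : ℝ, Tendsto (fun t : ℝ => M (x + s * t * I)) (nhdsWithin 0 {0}ᶜ)
      (nhds (M x)) := by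
    intro s
    refine hM.tendsto.comp (Tendsto.mono_left ?_ nhdsWithin_le_nhds)
    have : Continuous (fun t : ℝ => (x : ℂ) + s * t * I) := by fun_prop
    simpa using this.tendsto 0
  have h1 := hlim (-1)
  have h2 := (continuous_conj.tendsto _).comp (hlim 1)
  refine conj_eq_iff_im.1 (tendsto_nhds_unique (h2.congr' ?_) h1)
  filter_upwards [self_mem_nhdsWithin] with t ht
  have ht : t ≠ 0 := ht
  rw [Function.comp_apply, ← hsymm _ (by simpa using ht)]
  congr 1
  simp

/-- A Nevanlinna function on the slit plane which is nonpositive on the interval and vanishes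
at one of its points vanishes identically. -/
lemma eq_zero_of_monotoneOn (hol : DifferentiableOn ℂ M {z : ℂ | z.im ≠ 0 ∨ (a < z.re ∧ z.re < b)})
    (hreal : ∀ x ∈ Ioo a b, (M (x : ℂ)).im = 0)
    (hmono : MonotoneOn (fun x : ℝ => (M x).re) (Ioo a b))
    (hnonpos : ∀ x ∈ Ioo a b, (M (x : ℂ)).re ≤ 0) {x : ℝ} (hx : x ∈ Ioo a b)
    (hx0 : (M x).re = 0) {z : ℂ} (hz : z.im ≠ 0) : M z = 0 := by
  have han := hol.analyticOnNhd (isOpen_slitPlane_Ioo a b)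
  refine han.eqOn_zero_of_preconnected_of_frequently_eq_zero (isPreconnected_slitPlane_Ioo hx)
    (z₀ := (x : ℂ)) (Or.inr (by simpa using hx)) ?_ (Or.inl hz)
  have hzero : ∀ᶠ y : ℝ in nhdsWithin x (Ioi x), M (y : ℂ) = 0 := by
    filter_upwards [Ioo_mem_nhdsGT hx.2] with y hy
    have hy' : y ∈ Ioo a b := ⟨hx.1.trans hy.1, hy.2⟩
    refine Complex.ext (le_antisymm (hnonpos y hy') ?_) (hreal y hy')
    simpa [hx0] using hmono hx hy' hy.1.le
  have ht : Tendsto (fun y : ℝ => (y : ℂ)) (nhdsWithin x (Ioi x)) (nhdsWithin (x : ℂ) {(x : ℂ)}ᶜ) :=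
    tendsto_nhdsWithin_iff.2 ⟨(continuous_ofReal.tendsto x).mono_left nhdsWithin_le_nhds, by
      filter_upwards [self_mem_nhdsWithin] with y hy
      simpa using ne_of_gt hy⟩
  exact ht.frequently hzero.frequently

end SlitPlane

/-- Both forms of `Q` restrict to `(x - α)² M w` with a positive real weight `w`. -/
lemma exists_weight {M Q : ℂ → ℂ} {α : ℝ} {β : ℂ} (hβα : β ≠ (α : ℂ))
    (hM : ∀ᶠ x : ℝ in nhdsWithin α (Iio α), DifferentiableAt ℂ M x)
    (hQ : (∀ z : ℂ, Q z = (z - (α : ℂ)) ^ 2 * M z) ∨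
      (∀ z : ℂ, Q z = (z - (α : ℂ)) ^ 2 * M z / ((z - β) * (z - (starRingEnd ℂ) β)))) :
    ∃ w w' : ℝ → ℝ,
      (∀ᶠ x in nhdsWithin α (Iio α), 0 < w x ∧ |(x - α) * w' x| ≤ w x / 4) ∧
      ∀ᶠ x : ℝ in nhdsWithin α (Iio α), (deriv Q x).re =
        2 * (x - α) * ((M x).re * w x) +
          (x - α) ^ 2 * ((deriv M x).re * w x + (M x).re * w' x) := by
  rcases hQ with hQ | hQ
  · refine ⟨fun _ => 1, fun _ => 0, by simp, ?_⟩
    filter_upwards [hM] with x hx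
    have h1 := (((hasDerivAt_id (x : ℂ)).sub_const (α : ℂ)).pow 2).mul hx.hasDerivAt
    have hQeq : Q = ((fun z => id z - (α : ℂ)) ^ 2 * M) := funext hQ
    have e : 2 * ((x : ℂ) - α) * M x + ((x : ℂ) - α) ^ 2 * deriv M x =
        ((2 * (x - α) : ℝ) : ℂ) * M x + (((x - α) ^ 2 : ℝ) : ℂ) * deriv M x := by
      push_cast; ring
    rw [hQeq, h1.deriv]
    have e' := congrArg re e
    rw [add_re (_ * _ : ℂ), add_re (ofReal _ * _), re_ofReal_mul, re_ofReal_mul, ← add_re] at e'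
    refine Eq.trans (congrArg re ?_) (e'.trans (by ring))
    simp
  · set D : ℝ → ℝ := fun x => normSq (x - β) with hD
    have hDx : ∀ x : ℝ, ((x : ℂ) - β) * (x - (starRingEnd ℂ) β) = (D x : ℂ) := by
      intro x
      have := mul_conj ((x : ℂ) - β)
      rwa [map_sub, conj_ofReal] at this
    have hDc : Continuous D := by fun_prop
    have hDα : 0 < D α := normSq_pos.2 (sub_ne_zero.2 hβα.symm)
    have hDpos : ∀ᶠ x in nhdsWithin α (Iio α), 0 < D x :=
      (hDc.continuousAt.eventually_const_lt hDα).filter_mono nhdsWithin_le_nhds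
    set D' : ℝ → ℝ := fun x => 2 * (x - β.re) with hD'
    refine ⟨fun x => (D x)⁻¹, fun x => -D' x / D x ^ 2, eventually_abs_sub_mul_le
      (ContinuousAt.div (by fun_prop) (by fun_prop) (by positivity))
      (hDc.continuousAt.inv₀ hDα.ne') (inv_pos.2 hDα), ?_⟩
    filter_upwards [hM, hDpos] with x hx hDx0
    have hne : ((x : ℂ) - β) * (x - (starRingEnd ℂ) β) ≠ 0 := by
      rw [hDx]; exact_mod_cast hDx0.ne'
    have h1 := ((((hasDerivAt_id (x : ℂ)).sub_const (α : ℂ)).pow 2).mul hx.hasDerivAt).div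
      (((hasDerivAt_id (x : ℂ)).sub_const β).mul
        ((hasDerivAt_id (x : ℂ)).sub_const ((starRingEnd ℂ) β))) hne
    have hQeq : Q = ((fun z => id z - (α : ℂ)) ^ 2 * M) /
        ((fun z => id z - β) * fun z => id z - (starRingEnd ℂ) β) := funext hQ
    have hDne : (D x : ℂ) ≠ 0 := by exact_mod_cast hDx0.ne'
    have hD'x : ((x : ℂ) - (starRingEnd ℂ) β) + (x - β) = (D' x : ℂ) := by
      apply Complex.ext <;> simp [hD'] <;> ring
    have e : ((2 * ((x : ℂ) - α) * M x + ((x : ℂ) - α) ^ 2 * deriv M x) * (D x : ℂ) -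
          ((x : ℂ) - α) ^ 2 * M x * (D' x : ℂ)) / (D x : ℂ) ^ 2 =
        ((2 * (x - α) * (D x)⁻¹ : ℝ) : ℂ) * M x +
          (((x - α) ^ 2 * (D x)⁻¹ : ℝ) : ℂ) * deriv M x +
          (((x - α) ^ 2 * (-D' x / D x ^ 2) : ℝ) : ℂ) * M x := by
      push_cast
      field_simp
      ring
    have e' := congrArg re e
    rw [add_re, add_re, re_ofReal_mul, re_ofReal_mul, re_ofReal_mul] at e'
    rw [hQeq, h1.deriv]
    refine Eq.trans (congrArg re ?_) (e'.trans (by ring))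
    rw [← hDx, ← hD'x]
    simp

/-- Let `M` be a Nevanlinna function, not identically zero, extending
holomorphically to `(ℂ∖ℝ) ∪ (α−γ, α)`, with boundary limit `L = M(α−) ∈ (−∞,+∞]`
(as an extended real number), and let `Q(z) = (z−α)² M(z)` or
`Q(z) = (z−α)² M(z)/((z−β)(z−conj β))` with `β ∈ ℂ⁺ ∪ ℝ`, `β ≠ α`. Then `Q′ < 0` on
some interval `(α−ε, α)` iff `L ∈ (0,+∞]`, and `Q′ > 0` on some `(α−ε, α)` iff `L ≤ 0`. -/
theorem statement10 (M : ℂ → ℂ) (α γ : ℝ) (hγ : 0 < γ)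
    (hol : DifferentiableOn ℂ M {z : ℂ | z.im ≠ 0 ∨ (α - γ < z.re ∧ z.re < α)})
    (hsymm : ∀ z : ℂ, z.im ≠ 0 → M ((starRingEnd ℂ) z) = (starRingEnd ℂ) (M z))
    (him : ∀ z : ℂ, 0 < z.im → 0 ≤ (M z).im)
    (hne : ∃ z : ℂ, z.im ≠ 0 ∧ M z ≠ 0)
    (β : ℂ) (hβ : 0 ≤ β.im) (hβα : β ≠ (α : ℂ))
    (L : EReal)
    (hL : Tendsto (fun x : ℝ => ((M (x : ℂ)).re : EReal))
      (nhdsWithin α (Set.Iio α)) (nhds L))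
    (hLbot : L ≠ ⊥)
    (Q : ℂ → ℂ)
    (hQ : (∀ z : ℂ, Q z = (z - (α : ℂ)) ^ 2 * M z) ∨
          (∀ z : ℂ, Q z = (z - (α : ℂ)) ^ 2 * M z / ((z - β) * (z - (starRingEnd ℂ) β)))) :
    ((∃ ε > 0, ∀ x : ℝ, x ∈ Set.Ioo (α - ε) α → (deriv Q (x : ℂ)).re < 0) ↔ 0 < L) ∧
    ((∃ ε > 0, ∀ x : ℝ, x ∈ Set.Ioo (α - ε) α → 0 < (deriv Q (x : ℂ)).re) ↔ L ≤ 0) := by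
  have hexists : ∀ p : ℝ → Prop, (∃ ε > 0, ∀ x : ℝ, x ∈ Ioo (α - ε) α → p x) ↔
      ∀ᶠ x in nhdsWithin α (Iio α), p x := by
    intro p
    constructor
    · rintro ⟨ε, hε, h⟩
      filter_upwards [Ioo_mem_nhdsLT (sub_lt_self α hε)] with x hx using h x hx
    · intro h
      obtain ⟨l, hl, hsub⟩ := (mem_nhdsLT_iff_exists_Ioo_subset).1 h
      exact ⟨α - l, sub_pos.2 hl, fun x hx => hsub (by simpa using hx)⟩
  rw [hexists fun x => (deriv Q (x : ℂ)).re < 0, hexists fun x => 0 < (deriv Q (x : ℂ)).re]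
  set m : ℝ → ℝ := fun x => (M x).re with hm
  set m' : ℝ → ℝ := fun x => (deriv M x).re with hm'
  have hI : Ioo (α - γ) α ∈ nhdsWithin α (Iio α) := Ioo_mem_nhdsLT (sub_lt_self α hγ)
  have hanC : ∀ x ∈ Ioo (α - γ) α, AnalyticAt ℂ M (x : ℂ) := fun x hx =>
    hol.analyticOnNhd (isOpen_slitPlane_Ioo _ _) _ (Or.inr (by simpa using hx))
  have hderC : ∀ x ∈ Ioo (α - γ) α, HasDerivAt M (deriv M x) (x : ℂ) := fun x hx =>
    (hanC x hx).differentiableAt.hasDerivAt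
  have hder : ∀ x ∈ Ioo (α - γ) α, HasDerivAt m (m' x) x := fun x hx =>
    (hderC x hx).real_of_complex
  have hreal : ∀ x ∈ Ioo (α - γ) α, (M (x : ℂ)).im = 0 := fun x hx =>
    im_eq_zero_of_symm hsymm (hanC x hx).continuousAt
  have hnn : ∀ x ∈ Ioo (α - γ) α, 0 ≤ m' x := by
    intro x hx
    refine ge_of_tendsto (tendsto_im_div_of_hasDerivAt (hderC x hx) (hreal x hx)) ?_
    filter_upwards [self_mem_nhdsWithin] with t ht
    have ht : 0 < t := ht
    exact div_nonneg (him _ (by simpa using ht)) ht.le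
  have hmono : MonotoneOn m (Ioo (α - γ) α) := monotoneOn_Ioo_of_hasDerivAt_nonneg hder hnn
  have hlo : ∀ x ∈ Ioo (α - γ) α, ∀ y ∈ Ioo (α - γ) α,
      (m x - m y) ^ 2 ≤ m' x * m' y * (x - y) ^ 2 := fun x hx y hy =>
    loewner_inequality (hol.mono fun z (hz : 0 < z.im) => Or.inl hz.ne') him
      (hderC x hx) (hderC y hy) (hreal x hx) (hreal y hy)
  obtain ⟨w, w', hw, hQ'⟩ := exists_weight hβα
    (eventually_of_mem hI fun x hx => (hanC x hx).differentiableAt) hQ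
  have hpos : L ≤ 0 → ∀ᶠ x : ℝ in nhdsWithin α (Iio α), 0 < (deriv Q (x : ℂ)).re := by
    intro hL0
    have hnonpos : ∀ x ∈ Ioo (α - γ) α, m x ≤ 0 := by
      intro x hx
      have : (m x : EReal) ≤ L := by
        refine ge_of_tendsto hL ?_
        filter_upwards [Ioo_mem_nhdsLT hx.2] with y hy
        exact EReal.coe_le_coe_iff.2 (hmono hx ⟨hx.1.trans hy.1, hy.2⟩ hy.1.le)
      exact_mod_cast this.trans hL0
    obtain ⟨z, hz, hMz⟩ := hne
    have hneg : ∀ᶠ x in nhdsWithin α (Iio α), m x < 0 ∧ 0 ≤ m' x := by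
      filter_upwards [hI] with x hx
      exact ⟨(hnonpos x hx).lt_of_ne fun h0 =>
        hMz (eq_zero_of_monotoneOn hol hreal hmono hnonpos hx h0 hz), hnn x hx⟩
    filter_upwards [eventually_deriv_sq_mul_pos hw hneg, hQ'] with x hx hx'
    rwa [hx']
  have hneg : 0 < L → ∀ᶠ x : ℝ in nhdsWithin α (Iio α), (deriv Q (x : ℂ)).re < 0 := by
    intro hL0
    have hmpos : ∀ᶠ x in nhdsWithin α (Iio α), 0 < m x := by
      filter_upwards [hL.eventually_const_lt hL0] with x hx
      exact_mod_cast hx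
    obtain ⟨x₀, hx₀, hx₀I⟩ := (hmpos.and hI).exists
    have hbound : ∀ᶠ x in nhdsWithin α (Iio α), 0 < m x ∧ (α - x) * m' x ≤ 3 / 2 * m x := by
      have hlt : α - (α - x₀) / 3 < α := by linarith [hx₀I.2]
      filter_upwards [hmpos, Ioo_mem_nhdsLT hlt] with x hx hxI
      refine ⟨hx, ?_⟩
      have hx₀x : x₀ < x := by linarith [hxI.1, hx₀I.2]
      have key := deriv_mul_le_of_loewner (fun x hx => (hanC x hx).re_ofReal) hder hnn hlo
        hx₀I.1 hx₀x hxI.2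
      have h1 : α - x₀ ≤ 3 / 2 * (x - x₀) := by linarith [hxI.1]
      have h2 : (m x - m x₀) * (α - x₀) ≤ m x * (3 / 2 * (x - x₀)) :=
        mul_le_mul (by linarith) h1 (by linarith [hx₀I.2]) hx.le
      refine le_of_mul_le_mul_right ?_ (sub_pos.2 hx₀x)
      linarith
    filter_upwards [eventually_deriv_sq_mul_neg hw hbound, hQ'] with x hx hx'
    rwa [hx']
  have hexcl : (∀ᶠ x : ℝ in nhdsWithin α (Iio α), (deriv Q (x : ℂ)).re < 0) →
      ¬ ∀ᶠ x : ℝ in nhdsWithin α (Iio α), 0 < (deriv Q (x : ℂ)).re := fun h h' =>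
    let ⟨_, hx, hx'⟩ := (h.and h').exists
    lt_asymm hx hx'
  exact ⟨⟨fun h => not_le.1 fun hL0 => hexcl h (hpos hL0), hneg⟩,
    ⟨fun h => not_lt.1 fun hL0 => hexcl (hneg hL0) h, hpos⟩⟩
end

section
/- Let M be a Nevanlinna function, not identically zero, which extends holomorphically to (ℂ∖ℝ) ∪ (α, α+γ) for some α ∈ ℝ and γ > 0, and let L = lim_{x↓α} M(x) ∈ [−∞, +∞) (this limit exists since M is increasing on (α, α+γ)). Let β ∈ ℂ⁺ ∪ ℝ with β ≠ α, and let Q(z) = (z−α)²·M(z) or Q(z) = (z−α)²·M(z)/((z−β)(z−conj β)). Then: there exists ε > 0 such that Q′(x) < 0 for all x ∈ (α, α+ε) if and only if L ∈ [−∞, 0); and there exists ε > 0 such that Q′(x) > 0 for all x ∈ (α, α+ε) if and only if L ≥ 0. -/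
open Complex Filter Set

/-- The Schwarz–Pick inequality for the right half-plane at a real point with real value. -/
lemma mul_norm_deriv_le_of_re_pos {h : ℂ → ℂ} {s₀ h₀ : ℝ} (hs : 0 < s₀)
    (hd : DifferentiableOn ℂ h {s | 0 < s.re}) (hpos : ∀ s : ℂ, 0 < s.re → 0 < (h s).re)
    (h0 : h s₀ = h₀) : s₀ * ‖deriv h s₀‖ ≤ h₀ := by
  have hh₀ : 0 < h₀ := by simpa [h0] using hpos s₀ (by simpa using hs)
  have hopen : IsOpen {s : ℂ | 0 < s.re} := isOpen_lt continuous_const continuous_re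
  set c : ℂ → ℂ := fun ζ => s₀ * ((1 + ζ) / (1 - ζ)) with hc
  have hne : ∀ ζ ∈ Metric.ball (0 : ℂ) 1, 1 - ζ ≠ 0 := by
    intro ζ hζ h
    rw [mem_ball_zero_iff, ← sub_eq_zero.1 h] at hζ
    simp at hζ
  have hcre : ∀ ζ ∈ Metric.ball (0 : ℂ) 1, 0 < (c ζ).re := by
    intro ζ hζ
    have h1 : 0 < normSq (1 - ζ) := normSq_pos.2 (hne ζ hζ)
    have h2 : normSq ζ < 1 := by
      rw [normSq_eq_norm_sq]
      have := mem_ball_zero_iff.1 hζ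
      nlinarith [norm_nonneg ζ]
    have h3 : (c ζ).re = s₀ * ((1 - normSq ζ) / normSq (1 - ζ)) := by
      simp only [hc, re_ofReal_mul, div_re, normSq_apply ζ, add_re, sub_re, one_re, add_im,
        sub_im, one_im]
      ring
    rw [h3]
    exact mul_pos hs (div_pos (by linarith) h1)
  have hcd : ∀ ζ ∈ Metric.ball (0 : ℂ) 1, HasDerivAt c (s₀ * (2 / (1 - ζ) ^ 2)) ζ := by
    intro ζ hζ
    refine ((((hasDerivAt_id' ζ).const_add 1).div ((hasDerivAt_id' ζ).const_sub 1)
      (hne ζ hζ)).const_mul (s₀ : ℂ)).congr_deriv ?_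
    ring
  have hhd : ∀ s : ℂ, 0 < s.re → HasDerivAt h (deriv h s) s := fun s h =>
    (hd.differentiableAt (hopen.mem_nhds h)).hasDerivAt
  have hden : ∀ ζ ∈ Metric.ball (0 : ℂ) 1, h (c ζ) + h₀ ≠ 0 := by
    intro ζ hζ h1
    have := congrArg re h1
    simp only [add_re, ofReal_re, zero_re] at this
    linarith [hpos _ (hcre ζ hζ)]
  set F : ℂ → ℂ := fun ζ => (h (c ζ) - h₀) / (h (c ζ) + h₀) with hF
  have hFd : ∀ ζ ∈ Metric.ball (0 : ℂ) 1, HasDerivAt F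
      ((deriv h (c ζ) * (s₀ * (2 / (1 - ζ) ^ 2)) * (h (c ζ) + h₀) -
        (h (c ζ) - h₀) * (deriv h (c ζ) * (s₀ * (2 / (1 - ζ) ^ 2)))) / (h (c ζ) + h₀) ^ 2) ζ := by
    intro ζ hζ
    have h1 := (hhd _ (hcre ζ hζ)).comp ζ (hcd ζ hζ)
    exact (h1.sub_const (h₀ : ℂ)).div (h1.add_const (h₀ : ℂ)) (hden ζ hζ)
  have hc0 : c 0 = s₀ := by simp [hc]
  have hF0 : F 0 = 0 := by simp [hF, hc0, h0]
  have hmaps : MapsTo F (Metric.ball 0 1) (Metric.closedBall (F 0) 1) := by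
    intro ζ hζ
    rw [hF0, mem_closedBall_zero_iff, norm_div, div_le_one (norm_pos_iff.2 (hden ζ hζ)),
      ← sq_le_sq₀ (norm_nonneg _) (norm_nonneg _), ← normSq_eq_norm_sq, ← normSq_eq_norm_sq,
      normSq_apply, normSq_apply]
    simp only [sub_re, sub_im, add_re, add_im, ofReal_re, ofReal_im]
    nlinarith [mul_pos hh₀ (hpos _ (hcre ζ hζ))]
  have key := norm_deriv_le_one_of_mapsTo_ball
    (fun ζ hζ => (hFd ζ hζ).differentiableAt.differentiableWithinAt) hmaps one_pos
  have hder : deriv F 0 = deriv h s₀ * s₀ / h₀ := by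
    rw [(hFd 0 (by simp)).deriv, hc0, h0]
    have : (h₀ : ℂ) ≠ 0 := by exact_mod_cast hh₀.ne'
    field_simp
    ring
  rw [hder, norm_div, norm_mul, norm_real, norm_real, Real.norm_of_nonneg hs.le,
    Real.norm_of_nonneg hh₀.le, div_le_one hh₀] at key
  linarith

/-- The complement in `ℂ` of the real points outside the interval `(a, b)`. -/
def slitDomain (a b : ℝ) : Set ℂ := {z : ℂ | z.im ≠ 0 ∨ (a < z.re ∧ z.re < b)}

lemma isOpen_slitDomain (a b : ℝ) : IsOpen (slitDomain a b) :=
  (isOpen_ne_fun continuous_im continuous_const).union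
    ((isOpen_lt continuous_const continuous_re).inter (isOpen_lt continuous_re continuous_const))

lemma ofReal_mem_slitDomain {a b x : ℝ} (hx : x ∈ Ioo a b) : (x : ℂ) ∈ slitDomain a b :=
  Or.inr (by simpa using hx)

lemma isPreconnected_slitDomain {a b : ℝ} (hab : a < b) : IsPreconnected (slitDomain a b) := by
  have hmid : (a + b) / 2 ∈ Ioo a b := ⟨by linarith, by linarith⟩
  refine (StarConvex.isPathConnected (a := (((a + b) / 2 : ℝ) : ℂ)) ?_
    (ofReal_mem_slitDomain hmid)).isConnected.isPreconnected
  intro z hz p q hp hq hpq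
  simp only [slitDomain, mem_ofPred_eq, real_smul, add_im, add_re, mul_im, mul_re, ofReal_re,
    ofReal_im, mul_zero, zero_mul, add_zero, zero_add, sub_zero] at hz ⊢
  rcases hq.eq_or_lt with rfl | hq
  · right
    have : p = 1 := by linarith
    subst this
    constructor <;> linarith
  · rcases hz with hz | ⟨h1, h2⟩
    · exact Or.inl (mul_ne_zero hq.ne' hz)
    · right
      obtain rfl : p = 1 - q := by linarith
      constructor <;> nlinarith

/-- `s ↦ a + c s² / (1 + s²)` maps the right half-plane to a slit domain. -/
lemma add_mul_sq_div_mem_slitDomain {a c : ℝ} (hc : 0 < c) {s : ℂ} (hs : 0 < s.re) :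
    1 + s ^ 2 ≠ 0 ∧ (a + c * (s ^ 2 / (1 + s ^ 2)) : ℂ) ∈ slitDomain a (a + c) := by
  have hne : 1 + s ^ 2 ≠ 0 := by
    intro h
    have h1 := congrArg re h
    have h2 := congrArg im h
    simp only [pow_two, add_re, mul_re, add_im, mul_im, one_re, one_im, zero_re, zero_im] at h1 h2
    have : s.im = 0 := by
      have : s.re * s.im = 0 := by linarith
      exact (mul_eq_zero.1 this).resolve_left hs.ne'
    rw [this] at h1
    nlinarith
  refine ⟨hne, ?_⟩
  by_cases him : s.im = 0
  · obtain ⟨r, rfl⟩ : ∃ r : ℝ, s = r := ⟨s.re, by apply Complex.ext <;> simp [him]⟩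
    have hr : 0 < r := by simpa using hs
    have : (a + c * ((r : ℂ) ^ 2 / (1 + (r : ℂ) ^ 2)) : ℂ) =
        ((a + c * (r ^ 2 / (1 + r ^ 2)) : ℝ) : ℂ) := by push_cast; rfl
    rw [this]
    apply ofReal_mem_slitDomain
    have h1 : 0 < r ^ 2 / (1 + r ^ 2) := by positivity
    have h2 : r ^ 2 / (1 + r ^ 2) < 1 := by
      rw [div_lt_one (by positivity)]
      linarith
    constructor <;> nlinarith
  · left
    have hn := normSq_pos.2 hne
    have : (a + c * (s ^ 2 / (1 + s ^ 2)) : ℂ).im =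
        c * (2 * s.re * s.im / normSq (1 + s ^ 2)) := by
      rw [add_im, ofReal_im, im_ofReal_mul, div_im]
      simp only [pow_two, add_re, mul_re, add_im, mul_im, one_re, one_im]
      ring
    rw [this]
    have hnum : 2 * s.re * s.im ≠ 0 := by simp [hs.ne', him]
    exact mul_ne_zero hc.ne' (div_ne_zero hnum (ne_of_gt hn))

/-- Schwarz–Pick bound for a map from a slit domain to the plane cut along `[0, ∞)`. -/
lemma mul_norm_deriv_le_of_mapsTo_slitPlane {N : ℂ → ℂ} {a t : ℝ} (ht : 0 < t)
    (hd : DifferentiableOn ℂ N (slitDomain a (a + 5 * t)))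
    (hmap : ∀ z ∈ slitDomain a (a + 5 * t), -N z ∈ slitPlane)
    (hreal : (N (a + t : ℝ)).im = 0) :
    t * ‖deriv N (a + t : ℝ)‖ ≤ 5 / 4 * ‖N (a + t : ℝ)‖ := by
  set G : ℂ → ℂ := fun s => a + (5 * t : ℝ) * (s ^ 2 / (1 + s ^ 2)) with hG
  have hGm : ∀ s : ℂ, 0 < s.re → 1 + s ^ 2 ≠ 0 ∧ G s ∈ slitDomain a (a + 5 * t) := fun s hs =>
    add_mul_sq_div_mem_slitDomain (by positivity) hs
  have hGd : ∀ s : ℂ, 0 < s.re →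
      HasDerivAt G ((5 * t : ℝ) * (2 * s / (1 + s ^ 2) ^ 2)) s := by
    intro s hs
    have hp : HasDerivAt (fun s : ℂ => s ^ 2) (2 * s) s := by simpa using hasDerivAt_pow 2 s
    refine (((hp.div (hp.const_add 1) (hGm s hs).1).const_mul ((5 * t : ℝ) : ℂ)).const_add
      (a : ℂ)).congr_deriv ?_
    ring
  set h : ℂ → ℂ := fun s => exp (log (-N (G s)) / 2) with hh
  have hhd : ∀ s : ℂ, 0 < s.re → HasDerivAt h (exp (log (-N (G s)) / 2) *
      (-(deriv N (G s) * ((5 * t : ℝ) * (2 * s / (1 + s ^ 2) ^ 2))) / (-N (G s)) / 2)) s := by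
    intro s hs
    have hN := (hd.differentiableAt
      ((isOpen_slitDomain a (a + 5 * t)).mem_nhds (hGm s hs).2)).hasDerivAt
    exact (((hN.comp s (hGd s hs)).neg.clog (hmap _ (hGm s hs).2)).div_const 2).cexp
  have hpos : ∀ s : ℂ, 0 < s.re → 0 < (h s).re := by
    intro s hs
    have h1 := mem_slitPlane_iff_arg.1 (hmap _ (hGm s hs).2)
    have h2 : arg (-N (G s)) < Real.pi := lt_of_le_of_ne (arg_le_pi _) h1.1
    have h3 := neg_pi_lt_arg (-N (G s))
    rw [hh]
    simp only [exp_re]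
    refine mul_pos (Real.exp_pos _) (Real.cos_pos_of_mem_Ioo ?_)
    have : (log (-N (G s)) / 2).im = arg (-N (G s)) / 2 := by
      rw [← log_im]
      exact div_ofNat_im _ 2
    rw [this]
    constructor <;> linarith
  have hG0 : G ((1 / 2 : ℝ) : ℂ) = (a + t : ℝ) := by
    simp only [hG]
    push_cast
    ring
  set n := N (a + t : ℝ) with hn
  have hmem : ((a + t : ℝ) : ℂ) ∈ slitDomain a (a + 5 * t) :=
    ofReal_mem_slitDomain ⟨by linarith, by linarith⟩
  have hn0 : -n ∈ slitPlane := hmap _ hmem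
  have hnre : 0 < -n.re := by
    rcases hn0 with h | h
    · simpa using h
    · simp [hreal] at h
  have hnn : n ≠ 0 := by
    intro h
    simp [h] at hnre
  have hn' : -n = ((-n.re : ℝ) : ℂ) := by apply Complex.ext <;> simp [hreal]
  have h0 : h ((1 / 2 : ℝ) : ℂ) = (Real.exp (Real.log (-n.re) / 2) : ℝ) := by
    simp only [hh, hG0]
    rw [← hn, hn', ← ofReal_log hnre.le]
    push_cast
    rfl
  have key := mul_norm_deriv_le_of_re_pos (h := h) (s₀ := 1 / 2) (by norm_num)
    (fun s hs => (hhd s hs).differentiableAt.differentiableWithinAt) hpos h0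
  have hE := Real.exp_pos (Real.log (-n.re) / 2)
  have h0' : exp (log (-N (G ((1 / 2 : ℝ) : ℂ))) / 2) = (Real.exp (Real.log (-n.re) / 2) : ℝ) := h0
  rw [(hhd _ (by norm_num)).deriv, h0', hG0, ← hn, norm_mul, norm_real,
    Real.norm_of_nonneg hE.le] at key
  have h5 : -(deriv N (a + t : ℝ) * ((5 * t : ℝ) *
      (2 * ((1 / 2 : ℝ) : ℂ) / (1 + ((1 / 2 : ℝ) : ℂ) ^ 2) ^ 2))) / (-n) / 2 =
      ((8 / 5 * t : ℝ) : ℂ) * (deriv N (a + t : ℝ) / n) := by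
    push_cast
    field_simp
    ring
  rw [h5, norm_mul, norm_real, Real.norm_of_nonneg (by positivity), norm_div] at key
  have hnp := norm_pos_iff.2 hnn
  have h6 : 8 / 5 * t * (‖deriv N (a + t : ℝ)‖ / ‖n‖) ≤ 2 := by
    by_contra! hlt
    nlinarith [mul_lt_mul_of_pos_left hlt hE]
  have h7 : ‖deriv N (a + t : ℝ)‖ / ‖n‖ * ‖n‖ = ‖deriv N (a + t : ℝ)‖ := div_mul_cancel₀ _ hnp.ne'
  nlinarith [mul_le_mul_of_nonneg_right h6 hnp.le]

section Nevanlinna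

variable {M : ℂ → ℂ} {a b : ℝ}

lemma tendsto_ofReal_add_mul_I (x : ℝ) :
    Tendsto (fun y : ℝ => (x + y * I : ℂ)) (nhdsWithin 0 (Ioi 0)) (nhds (x : ℂ)) := by
  have : Continuous (fun y : ℝ => (x + y * I : ℂ)) := by fun_prop
  simpa using (this.tendsto 0).mono_left nhdsWithin_le_nhds

/-- A symmetric function is real on the interval across which it is continuous. -/
lemma im_eq_zero_of_symm_s11 (hd : DifferentiableOn ℂ M (slitDomain a b))
    (hsymm : ∀ z : ℂ, z.im ≠ 0 → M ((starRingEnd ℂ) z) = (starRingEnd ℂ) (M z))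
    {x : ℝ} (hx : x ∈ Ioo a b) : (M x).im = 0 := by
  have hc : ContinuousAt M x := (hd.differentiableAt
    ((isOpen_slitDomain a b).mem_nhds (ofReal_mem_slitDomain hx))).continuousAt
  have h1 := hc.tendsto.comp (tendsto_ofReal_add_mul_I x)
  have h2 := (continuous_conj.tendsto _).comp h1
  have hconj : Tendsto (fun y : ℝ => (starRingEnd ℂ) (x + y * I : ℂ)) (nhdsWithin 0 (Ioi 0))
      (nhds (x : ℂ)) := by
    simpa [Function.comp_def] using
      (continuous_conj.tendsto _).comp (tendsto_ofReal_add_mul_I x)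
  have h3 := hc.tendsto.comp hconj
  refine conj_eq_iff_im.1 (tendsto_nhds_unique h2 (h3.congr' ?_))
  filter_upwards [self_mem_nhdsWithin] with y hy
  exact hsymm _ (by simpa using (mem_Ioi.1 hy).ne')

/-- A Nevanlinna function has nonnegative derivative on the real line. -/
lemma re_deriv_nonneg (hd : DifferentiableOn ℂ M (slitDomain a b))
    (hsymm : ∀ z : ℂ, z.im ≠ 0 → M ((starRingEnd ℂ) z) = (starRingEnd ℂ) (M z))
    (him : ∀ z : ℂ, 0 < z.im → 0 ≤ (M z).im)
    {x : ℝ} (hx : x ∈ Ioo a b) : 0 ≤ (deriv M x).re := by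
  have h1 : HasDerivAt M (deriv M x) (x + ((0 : ℝ) : ℂ) * I) := by
    simpa using (hd.differentiableAt
      ((isOpen_slitDomain a b).mem_nhds (ofReal_mem_slitDomain hx))).hasDerivAt
  have h2 : HasDerivAt (fun y : ℝ => (x + y * I : ℂ)) I 0 := by
    simpa using ((hasDerivAt_id (0 : ℝ)).ofReal_comp.mul_const I).const_add (x : ℂ)
  have h3 : HasDerivAt (fun y : ℝ => (M (x + y * I)).im) (deriv M x).re 0 := by
    simpa [Function.comp_def] using
      imCLM.hasFDerivAt.comp_hasDerivAt (0 : ℝ) (h1.comp (0 : ℝ) h2)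
  have h4 := (hasDerivAt_iff_tendsto_slope.1 h3).mono_left
    (nhdsWithin_mono 0 (fun y (hy : y ∈ Ioi 0) => (mem_Ioi.1 hy).ne'))
  refine ge_of_tendsto h4 ?_
  filter_upwards [self_mem_nhdsWithin] with y hy
  have hy : 0 < y := hy
  have : 0 ≤ (M (x + y * I)).im := him _ (by simpa using hy)
  rw [slope_def_field]
  simp only [ofReal_zero, zero_mul, add_zero, im_eq_zero_of_symm_s11 hd hsymm hx, sub_zero]
  positivity

lemma monotoneOn_re (hd : DifferentiableOn ℂ M (slitDomain a b))
    (hsymm : ∀ z : ℂ, z.im ≠ 0 → M ((starRingEnd ℂ) z) = (starRingEnd ℂ) (M z))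
    (him : ∀ z : ℂ, 0 < z.im → 0 ≤ (M z).im) :
    MonotoneOn (fun x : ℝ => (M x).re) (Ioo a b) := by
  have h : ∀ x ∈ Ioo a b, HasDerivAt (fun x : ℝ => (M x).re) (deriv M x).re x := fun x hx =>
    (hd.differentiableAt ((isOpen_slitDomain a b).mem_nhds
      (ofReal_mem_slitDomain hx))).hasDerivAt.real_of_complex
  refine monotoneOn_of_deriv_nonneg (convex_Ioo a b)
    (fun x hx => (h x hx).continuousAt.continuousWithinAt) ?_ ?_
  · intro x hx
    rw [interior_Ioo] at hx
    exact (h x hx).differentiableAt.differentiableWithinAt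
  · intro x hx
    rw [interior_Ioo] at hx
    rw [(h x hx).deriv]
    exact re_deriv_nonneg hd hsymm him hx

/-- A Nevanlinna function is constant or has positive imaginary part in the upper half-plane. -/
lemma im_pos_or_eq (hd : DifferentiableOn ℂ M (slitDomain a b))
    (him : ∀ z : ℂ, 0 < z.im → 0 ≤ (M z).im) {x : ℝ} (hx : x ∈ Ioo a b)
    {z : ℂ} (hz : 0 < z.im) : 0 < (M z).im ∨ M z = M x := by
  have hopen : IsOpen {z : ℂ | 0 < z.im} := isOpen_lt continuous_const continuous_im
  have han : AnalyticOnNhd ℂ M {z : ℂ | 0 < z.im} :=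
    (hd.mono fun w (hw : 0 < w.im) => Or.inl hw.ne').analyticOnNhd hopen
  rcases han.is_constant_or_isOpen (convex_halfSpace_im_gt 0).isPreconnected with ⟨w, hw⟩ | h
  · right
    have hc : ContinuousAt M x := (hd.differentiableAt
      ((isOpen_slitDomain a b).mem_nhds (ofReal_mem_slitDomain hx))).continuousAt
    refine (hw z hz).trans (tendsto_nhds_unique ((tendsto_const_nhds (x := w)).congr' ?_)
      (hc.tendsto.comp (tendsto_ofReal_add_mul_I x)))
    filter_upwards [self_mem_nhdsWithin] with y hy
    exact (hw _ (by simpa using hy)).symm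
  · left
    have hsub : M '' {z : ℂ | 0 < z.im} ⊆ interior {w : ℂ | 0 ≤ w.im} := by
      refine interior_maximal ?_ (h _ subset_rfl hopen)
      rintro _ ⟨w, hw, rfl⟩
      exact him w hw
    rw [interior_setOfPred_le_im] at hsub
    exact hsub ⟨z, hz, rfl⟩

lemma neg_mem_slitPlane_of_re_neg (hd : DifferentiableOn ℂ M (slitDomain a b)) (hab : a < b)
    (hsymm : ∀ z : ℂ, z.im ≠ 0 → M ((starRingEnd ℂ) z) = (starRingEnd ℂ) (M z))
    (him : ∀ z : ℂ, 0 < z.im → 0 ≤ (M z).im)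
    (hneg : ∀ x : ℝ, x ∈ Ioo a b → (M x).re < 0) :
    ∀ z ∈ slitDomain a b, -M z ∈ slitPlane := by
  have hmid : (a + b) / 2 ∈ Ioo a b := ⟨by linarith, by linarith⟩
  have hup : ∀ z : ℂ, 0 < z.im → -M z ∈ slitPlane := by
    intro z hz
    rcases im_pos_or_eq hd him hmid hz with h | h
    · exact Or.inr (by simpa using h.ne')
    · exact Or.inl (by simpa [h] using hneg _ hmid)
  intro z hz
  rcases lt_trichotomy z.im 0 with h | h | h
  · have h1 := hup ((starRingEnd ℂ) z) (by simpa using h)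
    rw [hsymm z h.ne, mem_slitPlane_iff] at h1
    rw [mem_slitPlane_iff]
    simpa using h1
  · obtain ⟨x, rfl⟩ : ∃ x : ℝ, z = x := ⟨z.re, by apply Complex.ext <;> simp [h]⟩
    rcases hz with hz | hz
    · exact absurd h hz
    · exact Or.inl (by simpa using hneg x (by simpa using hz))
  · exact hup z h

/-- A nonzero Nevanlinna function that is nonnegative on `(a, b)` is positive there. -/
lemma re_pos_of_re_nonneg (hd : DifferentiableOn ℂ M (slitDomain a b))
    (hsymm : ∀ z : ℂ, z.im ≠ 0 → M ((starRingEnd ℂ) z) = (starRingEnd ℂ) (M z))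
    (him : ∀ z : ℂ, 0 < z.im → 0 ≤ (M z).im) (hne : ∃ z : ℂ, z.im ≠ 0 ∧ M z ≠ 0)
    (hnonneg : ∀ x : ℝ, x ∈ Ioo a b → 0 ≤ (M x).re) {x : ℝ} (hx : x ∈ Ioo a b) :
    0 < (M x).re := by
  refine lt_of_le_of_ne (hnonneg x hx) fun h0 => ?_
  have hzero : ∀ y ∈ Ioc a x, M y = 0 := by
    intro y hy
    have hy' : y ∈ Ioo a b := ⟨hy.1, hy.2.trans_lt hx.2⟩
    have h1 : (M y).re ≤ (M x).re := monotoneOn_re hd hsymm him hy' hx hy.2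
    exact Complex.ext (le_antisymm (h1.trans h0.symm.le) (hnonneg y hy'))
      (im_eq_zero_of_symm_s11 hd hsymm hy')
  have htend : Tendsto (fun y : ℝ => (y : ℂ)) (nhdsWithin x (Iio x))
      (nhdsWithin (x : ℂ) {(x : ℂ)}ᶜ) := by
    refine tendsto_nhdsWithin_iff.2
      ⟨(continuous_ofReal.tendsto x).mono_left nhdsWithin_le_nhds, ?_⟩
    filter_upwards [self_mem_nhdsWithin] with y hy
    simpa using (mem_Iio.1 hy).ne
  have hev : ∀ᶠ y : ℝ in nhdsWithin x (Iio x), M y = 0 := by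
    filter_upwards [Ioo_mem_nhdsLT hx.1] with y hy
    exact hzero y ⟨hy.1, hy.2.le⟩
  have han := hd.analyticOnNhd (isOpen_slitDomain a b)
  have hall := han.eqOn_zero_of_preconnected_of_frequently_eq_zero
    (isPreconnected_slitDomain (hx.1.trans hx.2)) (ofReal_mem_slitDomain hx)
    (htend.frequently hev.frequently)
  obtain ⟨z, hz, hMz⟩ := hne
  exact hMz (hall (Or.inl hz))

end Nevanlinna

/-- Sign of the derivative of `Q = (z - α)² M R` to the right of `α`, where `R > 0` has
logarithmic derivative `ρ`. -/
lemma eventually_sign_re_deriv {M Q : ℂ → ℂ} {α γ : ℝ} (hγ : 0 < γ)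
    (hd : DifferentiableOn ℂ M (slitDomain α (α + γ)))
    (hsymm : ∀ z : ℂ, z.im ≠ 0 → M ((starRingEnd ℂ) z) = (starRingEnd ℂ) (M z))
    (him : ∀ z : ℂ, 0 < z.im → 0 ≤ (M z).im) (hne : ∃ z : ℂ, z.im ≠ 0 ∧ M z ≠ 0)
    {L : EReal} (hL : Tendsto (fun x : ℝ => ((M (x : ℂ)).re : EReal))
      (nhdsWithin α (Ioi α)) (nhds L))
    (hQ : ∀ᶠ x : ℝ in nhdsWithin α (Ioi α), ∃ r ρ : ℝ, 0 < r ∧ |(x - α) * ρ| ≤ 1 / 2 ∧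
      (deriv Q x).re = r * (x - α) *
        (2 * (M x).re + (x - α) * (deriv M x).re + (x - α) * ρ * (M x).re)) :
    (L < 0 → ∀ᶠ x : ℝ in nhdsWithin α (Ioi α), (deriv Q x).re < 0) ∧
    (0 ≤ L → ∀ᶠ x : ℝ in nhdsWithin α (Ioi α), 0 < (deriv Q x).re) := by
  constructor
  · intro hL0
    have hev : ∀ᶠ x : ℝ in nhdsWithin α (Ioi α), (M x).re < 0 :=
      (hL.eventually_lt_const hL0).mono fun x hx => by exact_mod_cast hx
    obtain ⟨u, hu, hsub⟩ := mem_nhdsGT_iff_exists_Ioo_subset.1 hev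
    have hu : α < u := hu
    have hlt : α < α + min (u - α) γ / 5 := by
      have := lt_min (sub_pos.2 hu) hγ
      linarith
    filter_upwards [hQ, Ioo_mem_nhdsGT hlt] with x ⟨r, ρ, hr, hρ, hder⟩ hx
    have h1 := min_le_left (u - α) γ
    have h2 := min_le_right (u - α) γ
    have ht : 0 < x - α := sub_pos.2 hx.1
    have hx2 := hx.2
    have hss : slitDomain α (α + 5 * (x - α)) ⊆ slitDomain α (α + γ) := by
      rintro z (hz | hz)
      · exact Or.inl hz
      · exact Or.inr ⟨hz.1, by linarith [hz.2]⟩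
    have hd' := hd.mono hss
    have hb := mul_norm_deriv_le_of_mapsTo_slitPlane ht hd'
      (neg_mem_slitPlane_of_re_neg hd' (by linarith) hsymm him fun y hy =>
        hsub ⟨hy.1, by linarith [hy.2]⟩)
      (im_eq_zero_of_symm_s11 hd hsymm ⟨by linarith, by linarith⟩)
    rw [add_sub_cancel] at hb
    have hneg : (M x).re < 0 := hsub ⟨hx.1, by linarith⟩
    have hMx : M x = ((M x).re : ℂ) := by
      apply Complex.ext
      · simp
      · simpa using im_eq_zero_of_symm_s11 hd hsymm (x := x) ⟨by linarith, by linarith⟩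
    have hnorm : ‖M x‖ = -(M x).re := by
      rw [hMx, norm_real, Real.norm_of_nonpos (by simpa using hneg.le)]
      simp
    rw [hnorm] at hb
    have hre := mul_le_mul_of_nonneg_left (re_le_norm (deriv M x)) ht.le
    rw [hder]
    refine mul_neg_of_pos_of_neg (mul_pos hr ht) ?_
    nlinarith [abs_le.1 hρ]
  · intro hL0
    have hnonneg : ∀ x : ℝ, x ∈ Ioo α (α + γ) → 0 ≤ (M x).re := by
      intro x hx
      have : L ≤ ((M x).re : EReal) := by
        refine le_of_tendsto hL ?_
        filter_upwards [Ioo_mem_nhdsGT hx.1] with y hy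
        exact_mod_cast monotoneOn_re hd hsymm him ⟨hy.1, hy.2.trans hx.2⟩ hx hy.2.le
      exact_mod_cast hL0.trans this
    filter_upwards [hQ, Ioo_mem_nhdsGT (lt_add_of_pos_right α hγ)] with x ⟨r, ρ, hr, hρ, hder⟩ hx
    have ht : 0 < x - α := sub_pos.2 hx.1
    have hpos := re_pos_of_re_nonneg hd hsymm him hne hnonneg hx
    have hM' := mul_nonneg ht.le (re_deriv_nonneg hd hsymm him hx)
    rw [hder]
    refine mul_pos (mul_pos hr ht) ?_
    nlinarith [abs_le.1 hρ]

lemma exists_Ioo_iff_eventually_nhdsGT {α : ℝ} {p : ℝ → Prop} :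
    (∃ ε > 0, ∀ x : ℝ, x ∈ Ioo α (α + ε) → p x) ↔ ∀ᶠ x in nhdsWithin α (Ioi α), p x := by
  constructor
  · rintro ⟨ε, hε, h⟩
    filter_upwards [Ioo_mem_nhdsGT (lt_add_of_pos_right α hε)] with x hx using h x hx
  · intro h
    obtain ⟨u, hu, hsub⟩ := mem_nhdsGT_iff_exists_Ioo_subset.1 h
    exact ⟨u - α, sub_pos.2 hu, fun x hx => hsub ⟨hx.1, by linarith [hx.2]⟩⟩

/-- Let `M` be a Nevanlinna function, not identically zero, extending
holomorphically to `(ℂ∖ℝ) ∪ (α, α+γ)`, with boundary limit `L = M(α+) ∈ [−∞,+∞)`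
(as an extended real number), and let `Q(z) = (z−α)² M(z)` or
`Q(z) = (z−α)² M(z)/((z−β)(z−conj β))` with `β ∈ ℂ⁺ ∪ ℝ`, `β ≠ α`. Then `Q′ < 0` on
some interval `(α, α+ε)` iff `L ∈ [−∞,0)`, and `Q′ > 0` on some `(α, α+ε)` iff `L ≥ 0`. -/
theorem statement11 (M : ℂ → ℂ) (α γ : ℝ) (hγ : 0 < γ)
    (hol : DifferentiableOn ℂ M {z : ℂ | z.im ≠ 0 ∨ (α < z.re ∧ z.re < α + γ)})
    (hsymm : ∀ z : ℂ, z.im ≠ 0 → M ((starRingEnd ℂ) z) = (starRingEnd ℂ) (M z))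
    (him : ∀ z : ℂ, 0 < z.im → 0 ≤ (M z).im)
    (hne : ∃ z : ℂ, z.im ≠ 0 ∧ M z ≠ 0)
    (β : ℂ) (hβ : 0 ≤ β.im) (hβα : β ≠ (α : ℂ))
    (L : EReal)
    (hL : Tendsto (fun x : ℝ => ((M (x : ℂ)).re : EReal))
      (nhdsWithin α (Set.Ioi α)) (nhds L))
    (hLtop : L ≠ ⊤)
    (Q : ℂ → ℂ)
    (hQ : (∀ z : ℂ, Q z = (z - (α : ℂ)) ^ 2 * M z) ∨
          (∀ z : ℂ, Q z = (z - (α : ℂ)) ^ 2 * M z / ((z - β) * (z - (starRingEnd ℂ) β)))) :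
    ((∃ ε > 0, ∀ x : ℝ, x ∈ Set.Ioo α (α + ε) → (deriv Q (x : ℂ)).re < 0) ↔ L < 0) ∧
    ((∃ ε > 0, ∀ x : ℝ, x ∈ Set.Ioo α (α + ε) → 0 < (deriv Q (x : ℂ)).re) ↔ 0 ≤ L) := by
  have hd : DifferentiableOn ℂ M (slitDomain α (α + γ)) := hol
  have hMd : ∀ x ∈ Ioo α (α + γ), HasDerivAt M (deriv M x) x := fun x hx =>
    (hd.differentiableAt
      ((isOpen_slitDomain α (α + γ)).mem_nhds (ofReal_mem_slitDomain hx))).hasDerivAt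
  have hPd : ∀ x ∈ Ioo α (α + γ), HasDerivAt (fun z : ℂ => (z - α) ^ 2 * M z)
      (2 * (x - α) * M x + (x - α) ^ 2 * deriv M x) x := by
    intro x hx
    refine ((((hasDerivAt_id' (x : ℂ)).sub_const (α : ℂ)).pow 2).mul (hMd x hx)).congr_deriv ?_
    simp only [Pi.pow_apply]
    push_cast
    ring
  have hreal : ∀ x ∈ Ioo α (α + γ), M x = ((M x).re : ℂ) := fun x hx => by
    apply Complex.ext
    · simp
    · simpa using im_eq_zero_of_symm_s11 hd hsymm hx
  have hder : ∀ᶠ x : ℝ in nhdsWithin α (Ioi α), ∃ r ρ : ℝ, 0 < r ∧ |(x - α) * ρ| ≤ 1 / 2 ∧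
      (deriv Q x).re = r * (x - α) *
        (2 * (M x).re + (x - α) * (deriv M x).re + (x - α) * ρ * (M x).re) := by
    rcases hQ with hQ | hQ
    · filter_upwards [Ioo_mem_nhdsGT (lt_add_of_pos_right α hγ)] with x hx
      refine ⟨1, 0, one_pos, by norm_num, ?_⟩
      have h1 : (2 * (x - α) * M x + (x - α) ^ 2 * deriv M x : ℂ).re =
          ((2 * (x - α) : ℝ) * M x + ((x - α) ^ 2 : ℝ) * deriv M x : ℂ).re := by push_cast; rfl
      rw [funext hQ, (hPd x hx).deriv, h1, add_re, re_ofReal_mul, re_ofReal_mul]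
      ring
    · have hDre : ∀ x : ℝ, ((x : ℂ) - β) * (x - (starRingEnd ℂ) β) = (normSq (x - β) : ℝ) := by
        intro x
        rw [← mul_conj]
        simp
      have hD0 : normSq ((α : ℂ) - β) ≠ 0 := (normSq_pos.2 (sub_ne_zero.2 hβα.symm)).ne'
      have hDc : Continuous fun x : ℝ => normSq ((x : ℂ) - β) := by fun_prop
      have hDev : ∀ᶠ x : ℝ in nhds α, normSq ((x : ℂ) - β) ≠ 0 :=
        hDc.continuousAt.eventually_ne hD0
      have hρc : ContinuousAt
          (fun x : ℝ => |(x - α) * (-(2 * (x - β.re)) / normSq ((x : ℂ) - β))|) α :=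
        ((continuousAt_id.sub continuousAt_const).mul
          (ContinuousAt.div (by fun_prop) hDc.continuousAt hD0)).abs
      have hρev := hρc.tendsto.eventually_lt_const (u := 1 / 2) (by simp)
      filter_upwards [Ioo_mem_nhdsGT (lt_add_of_pos_right α hγ), nhdsWithin_le_nhds hDev,
        nhdsWithin_le_nhds hρev] with x hx hD hρ
      have hDpos : 0 < normSq ((x : ℂ) - β) := lt_of_le_of_ne (normSq_nonneg _) hD.symm
      refine ⟨(normSq ((x : ℂ) - β))⁻¹, -(2 * (x - β.re)) / normSq ((x : ℂ) - β),
        inv_pos.2 hDpos, hρ.le, ?_⟩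
      have hE : HasDerivAt (fun z : ℂ => (z - β) * (z - (starRingEnd ℂ) β))
          ((2 * (x - β.re) : ℝ) : ℂ) x := by
        refine (((hasDerivAt_id' (x : ℂ)).sub_const β).mul
          ((hasDerivAt_id' (x : ℂ)).sub_const ((starRingEnd ℂ) β))).congr_deriv ?_
        apply Complex.ext
        · simp
          ring
        · simp
      have hDC : ((normSq ((x : ℂ) - β) : ℝ) : ℂ) ≠ 0 := by exact_mod_cast hD
      have hQd := ((hPd x hx).div hE (by rw [hDre]; exact hDC)).deriv
      simp only [hDre] at hQd
      have h1 : deriv Q x = deriv ((fun z : ℂ => (z - α) ^ 2 * M z) /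
          fun z : ℂ => (z - β) * (z - (starRingEnd ℂ) β)) x := by
        congr 1
        exact funext hQ
      have h2 : deriv Q x = (((normSq ((x : ℂ) - β))⁻¹ * (x - α) : ℝ) : ℂ) *
          (((2 * (M x).re + (x - α) * (-(2 * (x - β.re)) / normSq ((x : ℂ) - β)) *
            (M x).re : ℝ) : ℂ)
            + ((x - α : ℝ) : ℂ) * deriv M x) := by
        rw [h1, hQd, hreal x hx]
        generalize normSq ((x : ℂ) - β) = D at hDC ⊢
        push_cast
        simp only [ofReal_re]
        field_simp
        ring
      rw [h2, re_ofReal_mul, add_re, re_ofReal_mul, ofReal_re]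
      ring
  obtain ⟨hneg, hpos⟩ := eventually_sign_re_deriv hγ hd hsymm him hne hL hder
  have hexcl : ¬ ((∀ᶠ x : ℝ in nhdsWithin α (Ioi α), (deriv Q x).re < 0) ∧
      ∀ᶠ x : ℝ in nhdsWithin α (Ioi α), 0 < (deriv Q x).re) := fun h => by
    obtain ⟨x, h1, h2⟩ := (h.1.and h.2).exists
    exact lt_asymm h1 h2
  rw [exists_Ioo_iff_eventually_nhdsGT, exists_Ioo_iff_eventually_nhdsGT]
  exact ⟨⟨fun h => not_le.1 fun h0 => hexcl ⟨h, hpos h0⟩, hneg⟩,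
    ⟨fun h => not_lt.1 fun h0 => hexcl ⟨hneg h0, h⟩, hpos⟩⟩
end

section
/- Let σ be a positive Borel measure on ℝ with ∫_ℝ dσ(s)/(s²+1) < ∞, let a ∈ ℝ and b ≥ 0, and define M(z) = a + b·z + ∫_ℝ (1/(s−z) − s/(s²+1)) dσ(s). Assume σ((−γ, 0)) = 0 for some γ > 0, so that M, and hence R(z) = z²·M(z), is real-analytic on (−γ, 0). Then lim_{x↑0} R′(x) = −σ({0}). -/
open Complex MeasureTheory Filter Set

/-- The Nevanlinna kernel as a multiple of the weight `(s² + 1)⁻¹`. -/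
lemma nevanlinnaKernel_eq (s : ℝ) {z : ℂ} (h : (s : ℂ) - z ≠ 0) :
    ((s : ℂ) - z)⁻¹ - (s : ℂ) / ((s : ℂ) ^ 2 + 1) =
      ((1 + z ^ 2) * ((s : ℂ) - z)⁻¹ + z) * ((s ^ 2 + 1 : ℝ)⁻¹ : ℝ) := by
  have h1 : (s : ℂ) ^ 2 + 1 ≠ 0 := by
    have : (s ^ 2 + 1 : ℝ) ≠ 0 := by positivity
    exact_mod_cast this
  push_cast
  field_simp
  ring

lemma norm_nevanlinnaKernel_le {s ε : ℝ} {z : ℂ} (hε : 0 < ε) (h : ε ≤ ‖(s : ℂ) - z‖) :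
    ‖((s : ℂ) - z)⁻¹ - (s : ℂ) / ((s : ℂ) ^ 2 + 1)‖ ≤
      ((1 + ‖z‖ ^ 2) * ε⁻¹ + ‖z‖) * (s ^ 2 + 1)⁻¹ := by
  have h0 : (s : ℂ) - z ≠ 0 := norm_pos_iff.mp (hε.trans_le h)
  rw [nevanlinnaKernel_eq s h0, norm_mul, norm_real, Real.norm_of_nonneg (by positivity)]
  gcongr
  refine (norm_add_le _ _).trans ?_
  rw [norm_mul, norm_inv]
  gcongr
  refine (norm_add_le _ _).trans ?_
  simp

lemma norm_inv_sub_sq_le {s ε : ℝ} {z : ℂ} (hε : 0 < ε) (h : ε ≤ ‖(s : ℂ) - z‖) :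
    ‖((s : ℂ) - z)⁻¹ ^ 2‖ ≤ (2 + (2 * ‖z‖ ^ 2 + 1) * (ε ^ 2)⁻¹) * (s ^ 2 + 1)⁻¹ := by
  have h1 : |s| ≤ ‖(s : ℂ) - z‖ + ‖z‖ := by
    have := norm_add_le ((s : ℂ) - z) z
    simpa using this
  rw [norm_pow, norm_inv]
  set d := ‖(s : ℂ) - z‖
  have hd : 0 < d := hε.trans_le h
  have h2 : s ^ 2 ≤ 2 * d ^ 2 + 2 * ‖z‖ ^ 2 := by
    rw [← sq_abs]
    nlinarith [sq_nonneg (d - ‖z‖), abs_nonneg s, norm_nonneg z]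
  rw [← div_eq_mul_inv _ (s ^ 2 + 1), le_div_iff₀ (by positivity)]
  calc d⁻¹ ^ 2 * (s ^ 2 + 1)
      ≤ d⁻¹ ^ 2 * (2 * d ^ 2 + 2 * ‖z‖ ^ 2 + 1) := by gcongr
    _ = 2 + (2 * ‖z‖ ^ 2 + 1) * (d ^ 2)⁻¹ := by field_simp; ring
    _ ≤ _ := by gcongr

/-- Differentiation under the integral sign at a point of a gap of `σ`. -/
lemma hasDerivAt_integral_nevanlinnaKernel {σ : Measure ℝ}
    (hσ : Integrable (fun s : ℝ => (s ^ 2 + 1)⁻¹) σ) {x ε : ℝ} (hε : 0 < ε)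
    (hgap : ∀ᵐ s ∂σ, 2 * ε ≤ |s - x|) :
    Integrable (fun s : ℝ => ((s : ℂ) - x)⁻¹ - (s : ℂ) / ((s : ℂ) ^ 2 + 1)) σ ∧
    Integrable (fun s : ℝ => ((s : ℂ) - x)⁻¹ ^ 2) σ ∧
    HasDerivAt (fun z : ℂ => ∫ s : ℝ, (((s : ℂ) - z)⁻¹ - (s : ℂ) / ((s : ℂ) ^ 2 + 1)) ∂σ)
      (∫ s : ℝ, ((s : ℂ) - x)⁻¹ ^ 2 ∂σ) (x : ℂ) := by
  have hdist : ∀ᵐ s : ℝ ∂σ, ∀ z ∈ Metric.ball (x : ℂ) ε, ε ≤ ‖(s : ℂ) - z‖ := by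
    filter_upwards [hgap] with s hs z hz
    have h1 : ‖(s : ℂ) - x‖ ≤ ‖(s : ℂ) - z‖ + ‖z - x‖ := by
      simpa using norm_add_le ((s : ℂ) - z) (z - x)
    rw [← ofReal_sub, norm_real, Real.norm_eq_abs] at h1
    rw [mem_ball_iff_norm] at hz
    linarith
  have hmeas : ∀ z : ℂ, AEStronglyMeasurable
      (fun s : ℝ => ((s : ℂ) - z)⁻¹ - (s : ℂ) / ((s : ℂ) ^ 2 + 1)) σ := fun z =>
    (by fun_prop : Measurable
      (fun s : ℝ => ((s : ℂ) - z)⁻¹ - (s : ℂ) / ((s : ℂ) ^ 2 + 1))).aestronglyMeasurable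
  have hkint : Integrable (fun s : ℝ => ((s : ℂ) - x)⁻¹ - (s : ℂ) / ((s : ℂ) ^ 2 + 1)) σ := by
    refine (hσ.const_mul ((1 + ‖(x : ℂ)‖ ^ 2) * ε⁻¹ + ‖(x : ℂ)‖)).mono' (hmeas x) ?_
    filter_upwards [hdist] with s hs
    exact norm_nevanlinnaKernel_le hε (hs x (Metric.mem_ball_self hε))
  refine ⟨hkint, hasDerivAt_integral_of_dominated_loc_of_deriv_le
    (F := fun (z : ℂ) (s : ℝ) => ((s : ℂ) - z)⁻¹ - (s : ℂ) / ((s : ℂ) ^ 2 + 1))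
    (F' := fun (z : ℂ) (s : ℝ) => ((s : ℂ) - z)⁻¹ ^ 2)
    (bound := fun s => (2 + (2 * (‖(x : ℂ)‖ + ε) ^ 2 + 1) * (ε ^ 2)⁻¹) * (s ^ 2 + 1)⁻¹)
    (Metric.ball_mem_nhds (x : ℂ) hε) (Eventually.of_forall hmeas) hkint
    (by fun_prop : Measurable (fun s : ℝ => ((s : ℂ) - x)⁻¹ ^ 2)).aestronglyMeasurable
    ?_ (hσ.const_mul _) ?_⟩
  · filter_upwards [hdist] with s hs z hz
    refine (norm_inv_sub_sq_le hε (hs z hz)).trans ?_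
    have hz' : ‖z‖ ≤ ‖(x : ℂ)‖ + ε := by
      have h1 : ‖z‖ ≤ ‖(x : ℂ)‖ + ‖z - x‖ := by simpa using norm_add_le (x : ℂ) (z - x)
      rw [mem_ball_iff_norm] at hz
      linarith
    gcongr
  · filter_upwards [hdist] with s hs z hz
    have h0 : (s : ℂ) - z ≠ 0 := norm_pos_iff.mp (hε.trans_le (hs z hz))
    have h1 := (((hasDerivAt_id z).const_sub (s : ℂ)).inv h0).sub_const
      ((s : ℂ) / ((s : ℂ) ^ 2 + 1))
    exact h1.congr_deriv (by simp [div_eq_mul_inv])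

/-- If `x` is at least as far from `s` as from `0`, then the integrand of `R′` is dominated by a multiple
of `(s² + 1)⁻¹` uniformly in `x ∈ [-1, 1]`. -/
lemma norm_two_mul_nevanlinnaKernel_add_le {s x : ℝ} (hx0 : x ≠ 0) (hx1 : |x| ≤ 1)
    (h : |x| ≤ |s - x|) :
    ‖2 * (x : ℂ) * (((s : ℂ) - x)⁻¹ - (s : ℂ) / ((s : ℂ) ^ 2 + 1)) +
      (x : ℂ) ^ 2 * ((s : ℂ) - x)⁻¹ ^ 2‖ ≤ 11 * (s ^ 2 + 1)⁻¹ := by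
  have hpos : 0 < |x| := abs_pos.mpr hx0
  have h' : |x| ≤ ‖(s : ℂ) - x‖ := by rwa [← ofReal_sub, norm_real, Real.norm_eq_abs]
  have hsq : |x| ^ 2 ≤ 1 := pow_le_one₀ hpos.le hx1
  have hk := norm_nevanlinnaKernel_le hpos h'
  have hq := norm_inv_sub_sq_le hpos h'
  have hw : 0 ≤ (s ^ 2 + 1)⁻¹ := by positivity
  simp only [norm_real, Real.norm_eq_abs] at hk hq
  refine (norm_add_le _ _).trans ?_
  rw [norm_mul, norm_mul, norm_mul, norm_pow (x : ℂ)]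
  simp only [norm_real, Real.norm_eq_abs, RCLike.norm_ofNat]
  calc _ ≤ 2 * |x| * (((1 + |x| ^ 2) * |x|⁻¹ + |x|) * (s ^ 2 + 1)⁻¹) +
        |x| ^ 2 * ((2 + (2 * |x| ^ 2 + 1) * (|x| ^ 2)⁻¹) * (s ^ 2 + 1)⁻¹) := by gcongr
    _ = (3 + 8 * |x| ^ 2) * (s ^ 2 + 1)⁻¹ := by field_simp; ring
    _ ≤ _ := by gcongr; linarith

/-- The integrand of `R′` converges pointwise to `-1` at `s = 0` and to `0` elsewhere. -/
lemma tendsto_two_mul_nevanlinnaKernel_add (s : ℝ) :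
    Tendsto (fun x : ℝ => 2 * (x : ℂ) * (((s : ℂ) - x)⁻¹ - (s : ℂ) / ((s : ℂ) ^ 2 + 1)) +
      (x : ℂ) ^ 2 * ((s : ℂ) - x)⁻¹ ^ 2) (nhdsWithin 0 (Iio 0))
      (nhds (indicator {0} (fun _ => (-1 : ℂ)) s)) := by
  rcases eq_or_ne s 0 with rfl | hs
  · refine tendsto_const_nhds.congr' ?_
    filter_upwards [self_mem_nhdsWithin] with x hx
    have : (x : ℂ) ≠ 0 := ofReal_ne_zero.mpr (ne_of_lt hx)
    simp
    field_simp
    norm_num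
  · have hs' : (s : ℂ) - ((0 : ℝ) : ℂ) ≠ 0 := by simpa using hs
    have hinv : ContinuousAt (fun x : ℝ => ((s : ℂ) - x)⁻¹) 0 :=
      ContinuousAt.inv₀ (by fun_prop) hs'
    have hcont : ContinuousAt (fun x : ℝ =>
        2 * (x : ℂ) * (((s : ℂ) - x)⁻¹ - (s : ℂ) / ((s : ℂ) ^ 2 + 1)) +
          (x : ℂ) ^ 2 * ((s : ℂ) - x)⁻¹ ^ 2) 0 := by
      have hx : ContinuousAt (fun x : ℝ => (x : ℂ)) 0 := by fun_prop
      exact ((hx.const_mul 2).mul (hinv.sub continuousAt_const)).add ((hx.pow 2).mul (hinv.pow 2))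
    have := hcont.tendsto.mono_left (nhdsWithin_le_nhds (s := Iio 0))
    simpa [hs] using this

/-- Let `M` be the Nevanlinna function with integral representation
data `(a, b, σ)`, and suppose `(−γ, 0)` is a gap of `σ`, so that `R(z) = z² M(z)` is
real-analytic on `(−γ, 0)`. Then `R′(x) → −σ({0})` as `x ↑ 0`. -/
theorem statement12 (σ : Measure ℝ) (a b : ℝ) (hb : 0 ≤ b)
    (hσ : Integrable (fun s : ℝ => (s ^ 2 + 1)⁻¹) σ)
    (γ : ℝ) (hγ : 0 < γ) (hgap : σ (Set.Ioo (-γ) 0) = 0)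
    (M : ℂ → ℂ)
    (hM : ∀ z : ℂ, z.im ≠ 0 ∨ (-γ < z.re ∧ z.re < 0) →
      M z = (a : ℂ) + (b : ℂ) * z +
        ∫ s : ℝ, (((s : ℂ) - z)⁻¹ - (s : ℂ) / ((s : ℂ) ^ 2 + 1)) ∂σ)
    (R : ℂ → ℂ) (hR : ∀ z : ℂ, R z = z ^ 2 * M z) :
    Tendsto (fun x : ℝ => deriv R (x : ℂ))
      (nhdsWithin 0 (Set.Iio 0)) (nhds (-((σ {0}).toReal : ℂ))) := by
  have hae : ∀ᵐ s ∂σ, s ∉ Ioo (-γ) 0 := measure_eq_zero_iff_ae_notMem.mp hgap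
  have hderiv : ∀ x ∈ Ioo (-γ) 0, deriv R (x : ℂ) =
      (2 * (a : ℂ) * x + 3 * b * (x : ℂ) ^ 2) +
      ∫ s : ℝ, (2 * (x : ℂ) * (((s : ℂ) - x)⁻¹ - (s : ℂ) / ((s : ℂ) ^ 2 + 1)) +
        (x : ℂ) ^ 2 * ((s : ℂ) - x)⁻¹ ^ 2) ∂σ := by
    rintro x ⟨hx1, hx2⟩
    have hε : 0 < min (-x) (x + γ) / 2 := by
      have : 0 < min (-x) (x + γ) := lt_min (by linarith) (by linarith)
      linarith
    obtain ⟨hk, hq, hd⟩ := hasDerivAt_integral_nevanlinnaKernel hσ (x := x) hε (by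
      filter_upwards [hae] with s hs
      rw [mul_div_cancel₀ _ two_ne_zero]
      rcases le_or_gt s (-γ) with h | h
      · exact (min_le_right _ _).trans ((by linarith : x + γ ≤ -(s - x)).trans (neg_le_abs _))
      · have : 0 ≤ s := not_lt.mp fun h0 => hs ⟨h, h0⟩
        exact (min_le_left _ _).trans ((by linarith : -x ≤ s - x).trans (le_abs_self _)))
    have hReq : R =ᶠ[nhds (x : ℂ)] fun z => z ^ 2 * ((a : ℂ) + (b : ℂ) * z +
        ∫ s : ℝ, (((s : ℂ) - z)⁻¹ - (s : ℂ) / ((s : ℂ) ^ 2 + 1)) ∂σ) := by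
      have hmem : re ⁻¹' Ioo (-γ) 0 ∈ nhds (x : ℂ) :=
        continuous_re.continuousAt.preimage_mem_nhds
          (Ioo_mem_nhds (by simpa using hx1) (by simpa using hx2))
      filter_upwards [hmem] with z hz
      rw [hR, hM z (Or.inr hz)]
    rw [hReq.deriv_eq, integral_add (hk.const_mul _) (hq.const_mul _), integral_const_mul,
      integral_const_mul]
    have hD := (hasDerivAt_pow 2 (x : ℂ)).mul
      ((((hasDerivAt_id (x : ℂ)).const_mul (b : ℂ)).const_add (a : ℂ)).add hd)
    refine (hD.congr_deriv ?_).deriv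
    simp only [id, Pi.add_apply]
    push_cast
    ring
  have hlim : Tendsto (fun x : ℝ =>
      ∫ s : ℝ, (2 * (x : ℂ) * (((s : ℂ) - x)⁻¹ - (s : ℂ) / ((s : ℂ) ^ 2 + 1)) +
        (x : ℂ) ^ 2 * ((s : ℂ) - x)⁻¹ ^ 2) ∂σ) (nhdsWithin 0 (Iio 0))
      (nhds (∫ s : ℝ, indicator {0} (fun _ => (-1 : ℂ)) s ∂σ)) := by
    refine tendsto_integral_filter_of_dominated_convergence (fun s => 11 * (s ^ 2 + 1)⁻¹)
      (Eventually.of_forall fun x => ?_) ?_ (hσ.const_mul 11)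
      (Eventually.of_forall tendsto_two_mul_nevanlinnaKernel_add)
    · exact (by fun_prop : Measurable fun s : ℝ =>
        2 * (x : ℂ) * (((s : ℂ) - x)⁻¹ - (s : ℂ) / ((s : ℂ) ^ 2 + 1)) +
          (x : ℂ) ^ 2 * ((s : ℂ) - x)⁻¹ ^ 2).aestronglyMeasurable
    · have hlow : -(min 1 (γ / 2)) < 0 := neg_lt_zero.mpr (lt_min one_pos (by linarith))
      filter_upwards [Ioo_mem_nhdsLT hlow] with x hx
      have h1 : -x ≤ 1 := by linarith [hx.1, min_le_left 1 (γ / 2)]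
      have h2 : -x ≤ γ / 2 := by linarith [hx.1, min_le_right 1 (γ / 2)]
      filter_upwards [hae] with s hs
      refine norm_two_mul_nevanlinnaKernel_add_le hx.2.ne (by rwa [abs_of_neg hx.2]) ?_
      rw [abs_of_neg hx.2]
      rcases le_or_gt s (-γ) with h | h
      · exact (by linarith : -x ≤ -(s - x)).trans (neg_le_abs _)
      · have : 0 ≤ s := not_lt.mp fun h0 => hs ⟨h, h0⟩
        exact (by linarith : -x ≤ s - x).trans (le_abs_self _)
  have hpoly : Tendsto (fun x : ℝ => 2 * (a : ℂ) * x + 3 * b * (x : ℂ) ^ 2)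
      (nhdsWithin 0 (Iio 0)) (nhds 0) := by
    have hc : Continuous fun x : ℝ => 2 * (a : ℂ) * x + 3 * b * (x : ℂ) ^ 2 := by fun_prop
    simpa using (hc.tendsto 0).mono_left (nhdsWithin_le_nhds (s := Iio 0))
  have hsum := hpoly.add hlim
  rw [integral_indicator_const _ (measurableSet_singleton 0)] at hsum
  have hval : (0 : ℂ) + σ.real {0} • (-1 : ℂ) = -((σ {0}).toReal : ℂ) := by
    simp [Measure.real]
  rw [hval] at hsum
  refine hsum.congr' ?_
  filter_upwards [Ioo_mem_nhdsLT (neg_lt_zero.mpr hγ)] with x hx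
  exact (hderiv x hx).symm
end

section
/- Let σ be a positive Borel measure on ℝ with ∫_ℝ dσ(s)/(s²+1) < ∞, let a ∈ ℝ and b ≥ 0, and define M(z) = a + b·z + ∫_ℝ (1/(s−z) − s/(s²+1)) dσ(s). Assume σ((−γ, 0)) = 0 for some γ > 0, σ({0}) = 0, and ∫_{(0,1/2)} dσ(s)/s = +∞. Let R(z) = z²·M(z). Then lim_{x↑0} R′(x)/x = +∞; in particular there exists ε > 0 such that R′(x) < 0 for all x ∈ (−ε, 0). -/
open Complex MeasureTheory Filter Set

/-- The integral `∫ (s - x)⁻¹ dσ(s)` over `(0, 1/2)` exceeds any bound for `x < 0` close to `0`,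
if `∫ s⁻¹ dσ(s)` over `(0, 1/2)` diverges. -/
lemma tendsto_setIntegral_inv_sub_atTop (σ : Measure ℝ)
    (hinv : ∀ x : ℝ, x < 0 → IntegrableOn (fun s : ℝ => (s - x)⁻¹) (Ioo (0 : ℝ) (1 / 2)) σ)
    (hdiv : ∫⁻ s in Ioo (0 : ℝ) (1 / 2), ENNReal.ofReal s⁻¹ ∂σ = ⊤) :
    Tendsto (fun x : ℝ => ∫ s in Ioo (0 : ℝ) (1 / 2), (s - x)⁻¹ ∂σ)
      (nhdsWithin 0 (Iio 0)) atTop := by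
  set u : ℕ → ℝ := fun n => -((n : ℝ) + 1)⁻¹ with hu
  have hu0 : ∀ n, u n < 0 := fun n => by simp only [hu]; rw [neg_lt_zero]; positivity
  have hum : Monotone u := by
    intro m n hmn
    simp only [hu]
    gcongr
  have hut : Tendsto u atTop (nhds 0) := by
    have := (tendsto_one_div_add_atTop_nhds_zero_nat (𝕜 := ℝ)).neg
    simpa [hu] using this
  have key : Tendsto (fun n => ∫⁻ s in Ioo (0 : ℝ) (1 / 2), ENNReal.ofReal (s - u n)⁻¹ ∂σ) atTop
      (nhds (∫⁻ s in Ioo (0 : ℝ) (1 / 2), ENNReal.ofReal s⁻¹ ∂σ)) := by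
    refine lintegral_tendsto_of_tendsto_of_monotone (fun n => by fun_prop) ?_ ?_
    · refine (ae_restrict_iff' measurableSet_Ioo).2 (Eventually.of_forall fun s hs m n hmn => ?_)
      refine ENNReal.ofReal_le_ofReal (inv_anti₀ ?_ ?_)
      · linarith [hs.1, hu0 n]
      · linarith [hum hmn]
    · refine (ae_restrict_iff' measurableSet_Ioo).2 (Eventually.of_forall fun s hs => ?_)
      refine (ENNReal.continuous_ofReal.tendsto _).comp ?_
      have : Tendsto (fun n => s - u n) atTop (nhds s) := by
        simpa using (tendsto_const_nhds (x := s)).sub hut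
      exact this.inv₀ hs.1.ne'
  rw [hdiv] at key
  refine tendsto_atTop.2 fun K => ?_
  obtain ⟨n, hn⟩ := (key.eventually (lt_mem_nhds (ENNReal.ofReal_lt_top (r := K)))).exists
  filter_upwards [Ioo_mem_nhdsLT (hu0 n)] with x hx
  have h1 : ∫ s in Ioo (0 : ℝ) (1 / 2), (s - u n)⁻¹ ∂σ
      ≤ ∫ s in Ioo (0 : ℝ) (1 / 2), (s - x)⁻¹ ∂σ := by
    refine setIntegral_mono_on (hinv _ (hu0 n)) (hinv _ hx.2) measurableSet_Ioo fun s hs => ?_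
    exact inv_anti₀ (by linarith [hs.1, hx.2]) (by linarith [hx.1])
  refine le_trans ?_ h1
  rw [← ofReal_integral_eq_lintegral_ofReal (hinv _ (hu0 n))] at hn
  · exact (ENNReal.ofReal_lt_ofReal_iff'.1 hn).1.le
  · refine (ae_restrict_iff' measurableSet_Ioo).2 (Eventually.of_forall fun s hs => ?_)
    exact inv_nonneg.2 (by linarith [hs.1, hu0 n])

/-- Decomposition of the Nevanlinna kernel. -/
lemma inv_sub_sub_div_eq {s x : ℝ} (h : s - x ≠ 0) :
    (s - x)⁻¹ - s / (s ^ 2 + 1) = ((1 + x ^ 2) * (s - x)⁻¹ + x) * (s ^ 2 + 1)⁻¹ := by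
  have : s ^ 2 + 1 ≠ 0 := by positivity
  field_simp
  ring

lemma inv_sq_le_of_le_abs_sub {s x d : ℝ} (hd : 0 < d) (h : d ≤ |s - x|) :
    ((s - x) ^ 2)⁻¹ ≤ (2 + (2 * x ^ 2 + 1) / d ^ 2) * (s ^ 2 + 1)⁻¹ := by
  have h2 : d ^ 2 ≤ (s - x) ^ 2 := by
    rw [← sq_abs (s - x)]; gcongr
  have hp : 0 < (s - x) ^ 2 := lt_of_lt_of_le (by positivity) h2
  rw [← div_eq_mul_inv, inv_eq_one_div, div_le_div_iff₀ hp (by positivity), one_mul]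
  have h3 : 2 * x ^ 2 + 1 ≤ (2 * x ^ 2 + 1) / d ^ 2 * (s - x) ^ 2 := by
    rw [div_mul_eq_mul_div, le_div_iff₀ (by positivity)]
    gcongr
  nlinarith [sq_nonneg (s - 2 * x)]

lemma integrable_nevanlinna_kernel {σ : Measure ℝ}
    (hσ : Integrable (fun s : ℝ => (s ^ 2 + 1)⁻¹) σ) {x d : ℝ} (hd : 0 < d)
    (h : ∀ᵐ s ∂σ, d ≤ |s - x|) :
    Integrable (fun s : ℝ => (s - x)⁻¹ - s / (s ^ 2 + 1)) σ := by
  refine (hσ.const_mul ((1 + x ^ 2) * d⁻¹ + |x|)).mono' (by fun_prop) ?_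
  filter_upwards [h] with s hs
  have h0 : 0 < |s - x| := hd.trans_le hs
  rw [inv_sub_sub_div_eq (abs_pos.1 h0), norm_mul, Real.norm_eq_abs, Real.norm_eq_abs,
    abs_of_nonneg (by positivity : (0 : ℝ) ≤ (s ^ 2 + 1)⁻¹)]
  gcongr
  refine (abs_add_le _ _).trans ?_
  rw [abs_mul, abs_inv, abs_of_nonneg (by positivity : (0 : ℝ) ≤ 1 + x ^ 2)]
  gcongr

lemma integrable_inv_sub_sq {σ : Measure ℝ}
    (hσ : Integrable (fun s : ℝ => (s ^ 2 + 1)⁻¹) σ) {x d : ℝ} (hd : 0 < d)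
    (h : ∀ᵐ s ∂σ, d ≤ |s - x|) :
    Integrable (fun s : ℝ => ((s - x) ^ 2)⁻¹) σ := by
  refine (hσ.const_mul (2 + (2 * x ^ 2 + 1) / d ^ 2)).mono' (by fun_prop) ?_
  filter_upwards [h] with s hs
  rw [Real.norm_of_nonneg (by positivity)]
  exact inv_sq_le_of_le_abs_sub hd hs

/-- Differentiation under the integral sign at a real point outside the support of `σ`. -/
lemma hasDerivAt_nevanlinna_integral {σ : Measure ℝ}
    (hσ : Integrable (fun s : ℝ => (s ^ 2 + 1)⁻¹) σ) {x d : ℝ} (hd : 0 < d)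
    (h : ∀ᵐ s ∂σ, d ≤ |s - x|) :
    HasDerivAt (fun z : ℂ => ∫ s : ℝ, (((s : ℂ) - z)⁻¹ - (s : ℂ) / ((s : ℂ) ^ 2 + 1)) ∂σ)
      (((∫ s : ℝ, ((s - x) ^ 2)⁻¹ ∂σ : ℝ) : ℂ)) (x : ℂ) := by
  have hlow : ∀ s : ℝ, d ≤ |s - x| → ∀ z ∈ Metric.ball (x : ℂ) (d / 2),
      |s - x| / 2 ≤ ‖(s : ℂ) - z‖ := by
    intro s hs z hz
    have h1 : ‖(s : ℂ) - x‖ = |s - x| := by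
      rw [← Complex.ofReal_sub, Complex.norm_real, Real.norm_eq_abs]
    have h2 : ‖z - x‖ < d / 2 := by simpa [dist_eq_norm] using hz
    have h3 : ‖(s : ℂ) - x‖ ≤ ‖(s : ℂ) - z‖ + ‖z - x‖ := by
      simpa using norm_add_le ((s : ℂ) - z) (z - x)
    linarith
  have main := (hasDerivAt_integral_of_dominated_loc_of_deriv_le (μ := σ)
    (F := fun (z : ℂ) (s : ℝ) => ((s : ℂ) - z)⁻¹ - (s : ℂ) / ((s : ℂ) ^ 2 + 1))
    (F' := fun (z : ℂ) (s : ℝ) => (((s : ℂ) - z) ^ 2)⁻¹)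
    (x₀ := (x : ℂ)) (bound := fun s => 4 * ((s - x) ^ 2)⁻¹)
    (Metric.ball_mem_nhds _ (half_pos hd)) ?_ ?_ ?_ ?_ ?_ ?_).2
  · have hJ : ((∫ s : ℝ, ((s - x) ^ 2)⁻¹ ∂σ : ℝ) : ℂ) = ∫ s : ℝ, (((s : ℂ) - x) ^ 2)⁻¹ ∂σ := by
      rw [← integral_complex_ofReal]
      push_cast
      rfl
    rw [hJ]
    exact main
  · exact Eventually.of_forall fun z => Measurable.aestronglyMeasurable (by fun_prop)
  · have := (integrable_nevanlinna_kernel hσ hd h).ofReal (𝕜 := ℂ)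
    refine this.congr (Eventually.of_forall fun s => ?_)
    simp
  · exact Measurable.aestronglyMeasurable (by fun_prop)
  · filter_upwards [h] with s hs z hz
    have h1 := hlow s hs z hz
    have h0 : 0 < |s - x| := hd.trans_le hs
    rw [norm_inv, norm_pow, ← sq_abs (s - x)]
    calc (‖(s : ℂ) - z‖ ^ 2)⁻¹ ≤ ((|s - x| / 2) ^ 2)⁻¹ := by gcongr
      _ = 4 * (|s - x| ^ 2)⁻¹ := by field_simp; norm_num
  · exact (integrable_inv_sub_sq hσ hd h).const_mul 4
  · filter_upwards [h] with s hs z hz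
    have h1 := hlow s hs z hz
    have h0 : 0 < |s - x| := hd.trans_le hs
    have hne : (s : ℂ) - z ≠ 0 := norm_pos_iff.1 (by linarith)
    have := (((hasDerivAt_id z).const_sub (s : ℂ)).fun_inv hne).sub_const
      ((s : ℂ) / ((s : ℂ) ^ 2 + 1))
    simpa using this

/-- The derivative of `z² M(z)`, divided by `z`, at a point of the gap. -/
lemma deriv_sq_mul_nevanlinna_re_div (σ : Measure ℝ) (a b : ℝ)
    (hσ : Integrable (fun s : ℝ => (s ^ 2 + 1)⁻¹) σ) {x d : ℝ} (hx : x ≠ 0) (hd : 0 < d)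
    (h : ∀ᵐ s ∂σ, d ≤ |s - x|) (R : ℂ → ℂ)
    (hR : R =ᶠ[nhds (x : ℂ)] fun z => z ^ 2 * ((a : ℂ) + (b : ℂ) * z +
        ∫ s : ℝ, (((s : ℂ) - z)⁻¹ - (s : ℂ) / ((s : ℂ) ^ 2 + 1)) ∂σ)) :
    (deriv R (x : ℂ)).re / x = 2 * a + 3 * b * x +
      ∫ s : ℝ, (2 * ((s - x)⁻¹ - s / (s ^ 2 + 1)) + x * ((s - x) ^ 2)⁻¹) ∂σ := by
  have hI : ∫ s : ℝ, (((s : ℂ) - x)⁻¹ - (s : ℂ) / ((s : ℂ) ^ 2 + 1)) ∂σ =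
      ((∫ s : ℝ, ((s - x)⁻¹ - s / (s ^ 2 + 1)) ∂σ : ℝ) : ℂ) := by
    rw [← integral_complex_ofReal]
    push_cast
    rfl
  have hD := ((hasDerivAt_pow 2 (x : ℂ)).fun_mul
    ((((hasDerivAt_id (x : ℂ)).const_mul (b : ℂ)).const_add (a : ℂ)).fun_add
      (hasDerivAt_nevanlinna_integral hσ hd h))).congr_of_eventuallyEq hR
  rw [hD.deriv]
  simp only [id, hI]
  rw [integral_add ((integrable_nevanlinna_kernel hσ hd h).const_mul 2)
    ((integrable_inv_sub_sq hσ hd h).const_mul x), integral_const_mul, integral_const_mul]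
  generalize (∫ s : ℝ, ((s - x)⁻¹ - s / (s ^ 2 + 1)) ∂σ) = I
  generalize (∫ s : ℝ, ((s - x) ^ 2)⁻¹ ∂σ) = J
  have : ((↑(2 : ℕ) * (x : ℂ) ^ (2 - 1) * (a + b * x + I) + (x : ℂ) ^ 2 * (b * 1 + J))) =
      ((2 * x * (a + b * x + I) + x ^ 2 * (b + J) : ℝ) : ℂ) := by
    push_cast
    ring
  rw [this, Complex.ofReal_re]
  field_simp
  ring

lemma kernel_lower_bound_of_pos_of_lt_half {s x : ℝ} (hx : x < 0) (hs : 0 < s) (hs' : s < 1 / 2) :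
    (s - x)⁻¹ - (s ^ 2 + 1)⁻¹ ≤
      2 * ((s - x)⁻¹ - s / (s ^ 2 + 1)) + x * ((s - x) ^ 2)⁻¹ := by
  have hp : 0 < s - x := by linarith
  have h1 : 0 ≤ (s - x)⁻¹ + x * ((s - x) ^ 2)⁻¹ := by
    have : (s - x)⁻¹ + x * ((s - x) ^ 2)⁻¹ = s * ((s - x) ^ 2)⁻¹ := by
      field_simp; ring
    rw [this]; positivity
  have h2 : 2 * (s / (s ^ 2 + 1)) ≤ (s ^ 2 + 1)⁻¹ := by
    rw [← mul_div_assoc, inv_eq_one_div]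
    gcongr
    linarith
  linarith

lemma kernel_lower_bound_of_le_abs_sub {s x d : ℝ} (hd : 0 < d) (hx : x < 0) (hx1 : -1 < x)
    (hs : d ≤ |s - x|) :
    -((4 / d + 4 + 3 / d ^ 2) * (s ^ 2 + 1)⁻¹) ≤
      2 * ((s - x)⁻¹ - s / (s ^ 2 + 1)) + x * ((s - x) ^ 2)⁻¹ := by
  have h0 : 0 < |s - x| := hd.trans_le hs
  have hx2 : x ^ 2 ≤ 1 := by nlinarith
  have h1 : |(s - x)⁻¹| ≤ d⁻¹ := by
    rw [abs_inv]; gcongr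
  have h2 : -(2 / d + 1) ≤ (1 + x ^ 2) * (s - x)⁻¹ + x := by
    have h3 : -d⁻¹ ≤ (s - x)⁻¹ := (abs_le.1 h1).1
    have : (0 : ℝ) < d⁻¹ := by positivity
    rw [div_eq_mul_inv]
    nlinarith [sq_nonneg x]
  have h4 : ((s - x) ^ 2)⁻¹ ≤ (2 + 3 / d ^ 2) * (s ^ 2 + 1)⁻¹ := by
    refine (inv_sq_le_of_le_abs_sub hd hs).trans ?_
    gcongr
    linarith
  have h5 : -((s - x) ^ 2)⁻¹ ≤ x * ((s - x) ^ 2)⁻¹ := by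
    have : (0 : ℝ) ≤ ((s - x) ^ 2)⁻¹ := by positivity
    nlinarith
  have h6 : -(2 / d + 1) * (s ^ 2 + 1)⁻¹ ≤ (s - x)⁻¹ - s / (s ^ 2 + 1) := by
    rw [inv_sub_sub_div_eq (abs_pos.1 h0)]
    gcongr
  have h7 : (4 / d + 4 + 3 / d ^ 2) * (s ^ 2 + 1)⁻¹ =
      2 * ((2 / d + 1) * (s ^ 2 + 1)⁻¹) + (2 + 3 / d ^ 2) * (s ^ 2 + 1)⁻¹ := by ring
  rw [h7]
  linarith

/-- Let `M` be the Nevanlinna function with integral representation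
data `(a, b, σ)`, suppose `(−γ, 0)` is a gap of `σ`, `σ({0}) = 0` and
`∫_{(0,1/2)} dσ(s)/s = +∞`, and let `R(z) = z² M(z)`. Then `R′(x)/x → +∞` as `x ↑ 0`;
in particular `R′ < 0` on some interval `(−ε, 0)`. -/
theorem statement13 (σ : Measure ℝ) (a b : ℝ) (hb : 0 ≤ b)
    (hσ : Integrable (fun s : ℝ => (s ^ 2 + 1)⁻¹) σ)
    (γ : ℝ) (hγ : 0 < γ) (hgap : σ (Set.Ioo (-γ) 0) = 0)
    (hpoint : σ {0} = 0)
    (hdiv : ∫⁻ s in Set.Ioo (0 : ℝ) (1 / 2), ENNReal.ofReal s⁻¹ ∂σ = ⊤)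
    (M : ℂ → ℂ)
    (hM : ∀ z : ℂ, z.im ≠ 0 ∨ (-γ < z.re ∧ z.re < 0) →
      M z = (a : ℂ) + (b : ℂ) * z +
        ∫ s : ℝ, (((s : ℂ) - z)⁻¹ - (s : ℂ) / ((s : ℂ) ^ 2 + 1)) ∂σ)
    (R : ℂ → ℂ) (hR : ∀ z : ℂ, R z = z ^ 2 * M z) :
    Tendsto (fun x : ℝ => (deriv R (x : ℂ)).re / x) (nhdsWithin 0 (Set.Iio 0)) atTop ∧
    ∃ ε > 0, ∀ x : ℝ, x ∈ Set.Ioo (-ε) 0 → (deriv R (x : ℂ)).re < 0 := by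
  have hae : ∀ᵐ s ∂σ, s ≤ -γ ∨ 0 < s := by
    have h1 : ∀ᵐ s ∂σ, s ∉ Ioo (-γ) 0 := measure_eq_zero_iff_ae_notMem.1 hgap
    have h2 : ∀ᵐ s ∂σ, s ∉ ({0} : Set ℝ) := measure_eq_zero_iff_ae_notMem.1 hpoint
    filter_upwards [h1, h2] with s h1 h2
    by_contra! hc
    exact h1 ⟨hc.1, lt_of_le_of_ne hc.2 h2⟩
  have hdist : ∀ x : ℝ, -γ < x → x < 0 → ∀ᵐ s ∂σ, min (-x) (γ + x) ≤ |s - x| := by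
    intro x hx hx0
    filter_upwards [hae] with s hs
    rcases hs with hs | hs
    · exact (min_le_right _ _).trans (le_abs.2 (Or.inr (by linarith)))
    · exact (min_le_left _ _).trans (le_abs.2 (Or.inl (by linarith)))
  have hpos : ∀ x : ℝ, -γ < x → x < 0 → 0 < min (-x) (γ + x) := fun x hx hx0 =>
    lt_min (by linarith) (by linarith)
  have hinv : ∀ x : ℝ, x < 0 →
      IntegrableOn (fun s : ℝ => (s - x)⁻¹) (Ioo (0 : ℝ) (1 / 2)) σ := by
    intro x hx
    refine (hσ.integrableOn.const_mul ((-x)⁻¹ * 2)).mono' (by fun_prop) ?_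
    refine (ae_restrict_iff' measurableSet_Ioo).2 (Eventually.of_forall fun s hs => ?_)
    have hp : 0 < s - x := by linarith [hs.1]
    have hx' : 0 < -x := by linarith
    rw [Real.norm_of_nonneg (by positivity), mul_assoc]
    have h1 : (s - x)⁻¹ ≤ (-x)⁻¹ := inv_anti₀ hx' (by linarith [hs.1])
    have h2 : 1 ≤ 2 * (s ^ 2 + 1)⁻¹ := by
      rw [← div_eq_mul_inv, le_div_iff₀ (by positivity)]
      nlinarith [hs.1, hs.2]
    have h3 : 0 < (-x)⁻¹ := by positivity
    nlinarith
  set d : ℝ := min (γ / 2) (1 / 2) with hd_def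
  have hd : 0 < d := lt_min (by linarith) (by norm_num)
  set C : ℝ := 4 / d + 4 + 3 / d ^ 2 with hC
  have hC1 : 1 ≤ C := by
    have : 0 < 4 / d := by positivity
    have : 0 < 3 / d ^ 2 := by positivity
    linarith
  have hlim : Tendsto (fun x : ℝ => (deriv R (x : ℂ)).re / x) (nhdsWithin 0 (Set.Iio 0)) atTop := by
    have hT := tendsto_atTop_add_const_right _ (2 * a - 3 * b - C * ∫ s : ℝ, (s ^ 2 + 1)⁻¹ ∂σ)
      (tendsto_setIntegral_inv_sub_atTop σ hinv hdiv)
    refine tendsto_atTop_mono' _ ?_ hT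
    filter_upwards [Ioo_mem_nhdsLT (neg_lt_zero.2 hd)] with x hx
    have hxγ : -γ / 2 < x := by linarith [hx.1, min_le_left (γ / 2) (1 / 2 : ℝ)]
    have hxγ' : -γ < x := by linarith
    have hx1 : -1 < x := by linarith [hx.1, min_le_right (γ / 2) (1 / 2 : ℝ)]
    have hRloc : R =ᶠ[nhds (x : ℂ)] fun z => z ^ 2 * ((a : ℂ) + (b : ℂ) * z +
        ∫ s : ℝ, (((s : ℂ) - z)⁻¹ - (s : ℂ) / ((s : ℂ) ^ 2 + 1)) ∂σ) := by
      have : Complex.re ⁻¹' Ioo (-γ) 0 ∈ nhds (x : ℂ) :=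
        (isOpen_Ioo.preimage Complex.continuous_re).mem_nhds
          ⟨by simpa using hxγ', by simpa using hx.2⟩
      filter_upwards [this] with z hz
      rw [hR, hM z (Or.inr hz)]
    rw [deriv_sq_mul_nevanlinna_re_div σ a b hσ hx.2.ne (hpos x hxγ' hx.2) (hdist x hxγ' hx.2)
      R hRloc]
    have hle : ∫ s : ℝ, ((Ioo (0 : ℝ) (1 / 2)).indicator (fun s => (s - x)⁻¹) s
        - C * (s ^ 2 + 1)⁻¹) ∂σ ≤
        ∫ s : ℝ, (2 * ((s - x)⁻¹ - s / (s ^ 2 + 1)) + x * ((s - x) ^ 2)⁻¹) ∂σ := by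
      refine integral_mono_ae
        (((hinv x hx.2).integrable_indicator measurableSet_Ioo).sub (hσ.const_mul C))
        (((integrable_nevanlinna_kernel hσ (hpos x hxγ' hx.2) (hdist x hxγ' hx.2)).const_mul 2).add
        ((integrable_inv_sub_sq hσ (hpos x hxγ' hx.2) (hdist x hxγ' hx.2)).const_mul x)) ?_
      filter_upwards [hae] with s hs
      by_cases hmem : s ∈ Ioo (0 : ℝ) (1 / 2)
      · rw [indicator_of_mem hmem]
        refine le_trans ?_ (kernel_lower_bound_of_pos_of_lt_half hx.2 hmem.1 hmem.2)
        have : (0 : ℝ) < (s ^ 2 + 1)⁻¹ := by positivity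
        nlinarith
      · rw [indicator_of_notMem hmem, zero_sub]
        refine kernel_lower_bound_of_le_abs_sub hd hx.2 hx1 ?_
        rcases hs with hs | hs
        · exact (min_le_left _ _).trans (le_abs.2 (Or.inr (by linarith)))
        · have : 1 / 2 ≤ s := by
            by_contra! hc
            exact hmem ⟨hs, hc⟩
          exact (min_le_right _ _).trans (le_abs.2 (Or.inl (by linarith [hx.2])))
    rw [integral_sub ((hinv x hx.2).integrable_indicator measurableSet_Ioo) (hσ.const_mul C),
      integral_indicator measurableSet_Ioo, integral_const_mul] at hle
    nlinarith
  refine ⟨hlim, ?_⟩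
  obtain ⟨l, hl, hsub⟩ := mem_nhdsLT_iff_exists_Ioo_subset.1 (hlim.eventually_gt_atTop 0)
  refine ⟨-l, neg_pos.2 hl, fun x hx => ?_⟩
  rw [neg_neg] at hx
  have h : 0 < (deriv R (x : ℂ)).re / x := hsub hx
  exact ((div_pos_iff.1 h).resolve_left fun h => h.2.not_gt hx.2).1
end

section
/- Let α, β ∈ ℝ with α ≠ β. Suppose U and V are Nevanlinna functions, neither identically zero, satisfying U(z) = −((z−α)²/(z−β)²)·V(z) for all z ∈ ℂ∖ℝ. Then there exists c ∈ ℝ with c·(β−α) < 0 such that U(z) = c·(1 − (β−α)/(β−z)) and V(z) = c·(−1 + (α−β)/(α−z)) for all z ∈ ℂ∖ℝ. -/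
open Complex Filter Set

/-- A Nevanlinna function. -/
structure IsNevanlinna (M : ℂ → ℂ) : Prop where
  holo : DifferentiableOn ℂ M {z : ℂ | z.im ≠ 0}
  symm : ∀ z : ℂ, z.im ≠ 0 → M ((starRingEnd ℂ) z) = (starRingEnd ℂ) (M z)
  im_nonneg : ∀ z : ℂ, 0 < z.im → 0 ≤ (M z).im

/-- A holomorphic function on the strip `0 < Im ζ < π` whose argument at `ζ` is bounded by
`min (Im ζ) (π - Im ζ)` is real-valued. -/
lemma im_eq_zero_of_sector_bound {H : ℂ → ℂ}
    (hH : DifferentiableOn ℂ H (Complex.im ⁻¹' Ioo 0 Real.pi))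
    (hsector : ∀ ζ : ℂ, ζ.im ∈ Ioo 0 Real.pi →
      |(H ζ).im * Real.cos ζ.im| ≤ (H ζ).re * Real.sin ζ.im)
    {ζ : ℂ} (hζ : ζ.im ∈ Ioo 0 Real.pi) : (H ζ).im = 0 := by
  have hre : ∀ ζ : ℂ, ζ.im ∈ Ioo 0 Real.pi → 0 < (H ζ + 1).re := by
    intro ζ hζ
    have hsin := Real.sin_pos_of_mem_Ioo hζ
    have h := (abs_nonneg _).trans (hsector ζ hζ)
    have : 0 ≤ (H ζ).re := nonneg_of_mul_nonneg_left h hsin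
    simp only [add_re, one_re]
    linarith
  have harg : ∀ ζ : ℂ, ζ.im ∈ Ioo 0 Real.pi → ∀ δ ∈ Ioo 0 (Real.pi / 2),
      Real.sin ζ.im = Real.sin δ → |(H ζ + 1).arg| ≤ δ := by
    intro ζ hζ δ hδ hsinδ
    have hsin := Real.sin_pos_of_mem_Ioo hζ
    have h := (hre ζ hζ)
    have hb : |(H ζ + 1).im * Real.cos ζ.im| ≤ (H ζ + 1).re * Real.sin ζ.im := by
      have := hsector ζ hζ
      simp only [add_re, one_re, add_im, one_im, add_zero]
      nlinarith
    have hn : 0 < ‖H ζ + 1‖ := norm_pos_iff.2 fun h0 => by simp [h0] at h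
    have hsq : (H ζ + 1).im ^ 2 ≤ (Real.sin δ * ‖H ζ + 1‖) ^ 2 := by
      have h1 := pow_le_pow_left₀ (abs_nonneg _) hb 2
      rw [sq_abs] at h1
      have h2 := Real.sin_sq_add_cos_sq ζ.im
      rw [← hsinδ, mul_pow, Complex.sq_norm, Complex.normSq_apply]
      nlinarith
    have hδs : 0 < Real.sin δ := hsinδ ▸ hsin
    have habs := abs_le_of_sq_le_sq hsq (by positivity)
    have hdiv : |(H ζ + 1).im / ‖H ζ + 1‖| ≤ Real.sin δ := by
      rw [abs_div, abs_of_pos hn, div_le_iff₀ hn]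
      exact habs
    rw [Complex.arg_of_re_nonneg h.le]
    have hmem : δ ∈ Icc (-(Real.pi / 2)) (Real.pi / 2) :=
      ⟨by linarith [hδ.1, hδ.2], hδ.2.le⟩
    rw [abs_le] at hdiv ⊢
    constructor
    · rw [Real.le_arcsin_iff_sin_le' ⟨by linarith [hδ.2], by linarith [hδ.1, hδ.2]⟩, Real.sin_neg]
      exact hdiv.1
    · rw [Real.arcsin_le_iff_le_sin' ⟨by linarith [hδ.1, hδ.2], hδ.2⟩]
      exact hdiv.2
  have hbound : ∀ s : ℝ, |s| = 1 → ∀ δ ∈ Ioo 0 (Real.pi / 2), ζ.im ∈ Icc δ (Real.pi - δ) →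
      s * (H ζ + 1).arg ≤ δ := by
    intro s hs δ hδ hζδ
    set E : ℂ → ℂ := fun ζ => cexp (-(s * I) * Complex.log (H ζ + 1)) with hE
    have hnorm : ∀ ζ, ‖E ζ‖ = Real.exp (s * (H ζ + 1).arg) := by
      intro ζ
      simp [hE, Complex.norm_exp, Complex.log_im]
    have hsub : Complex.im ⁻¹' Icc δ (Real.pi - δ) ⊆ Complex.im ⁻¹' Ioo 0 Real.pi := by
      intro ξ hξ
      exact ⟨by linarith [hξ.1, hδ.1], by linarith [hξ.2, hδ.1]⟩
    have hEd : DifferentiableOn ℂ E (Complex.im ⁻¹' Ioo 0 Real.pi) := by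
      refine ((DifferentiableOn.clog (hH.add_const 1) ?_).const_mul _).cexp
      exact fun ξ hξ => Or.inl (hre ξ hξ)
    have hcl : DiffContOnCl ℂ E (Complex.im ⁻¹' Ioo δ (Real.pi - δ)) := by
      apply DifferentiableOn.diffContOnCl
      refine hEd.mono (Subset.trans ?_ hsub)
      refine closure_minimal (preimage_mono Ioo_subset_Icc_self) ?_
      exact isClosed_Icc.preimage Complex.continuous_im
    have hedge : ∀ ξ : ℂ, ξ.im ∈ Ioo 0 Real.pi → Real.sin ξ.im = Real.sin δ →
        ‖E ξ‖ ≤ Real.exp δ := by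
      intro ξ hξ hsin
      rw [hnorm]
      refine Real.exp_le_exp.2 ((le_abs_self _).trans ?_)
      rw [abs_mul, hs, one_mul]
      exact harg ξ hξ δ hδ hsin
    have hfin : ‖E ζ‖ ≤ Real.exp δ := by
      refine PhragmenLindelof.horizontal_strip hcl ?_ ?_ ?_ hζδ.1 hζδ.2
      · refine ⟨0, div_pos Real.pi_pos (by linarith [hδ.2]), 0, ?_⟩
        refine Asymptotics.IsBigO.of_bound (Real.exp Real.pi) (Eventually.of_forall fun ξ => ?_)
        rw [hnorm]
        simp only [zero_mul, Real.exp_zero, norm_one, mul_one]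
        refine Real.exp_le_exp.2 ((le_abs_self _).trans ?_)
        rw [abs_mul, hs, one_mul]
        exact Complex.abs_arg_le_pi _
      · intro ξ hξ
        exact hedge ξ (by rw [hξ]; exact ⟨hδ.1, by linarith [hδ.2, hδ.1]⟩) (by rw [hξ])
      · intro ξ hξ
        exact hedge ξ (by rw [hξ]; exact ⟨by linarith [hδ.2, hδ.1], by linarith [hδ.1]⟩)
          (by rw [hξ, Real.sin_pi_sub])
    rw [hnorm] at hfin
    exact Real.exp_le_exp.1 hfin
  have hlim : ∀ s : ℝ, |s| = 1 → s * (H ζ + 1).arg ≤ 0 := by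
    intro s hs
    refine le_of_forall_pos_le_add fun ε hε => ?_
    have hpi := Real.pi_pos
    obtain ⟨δ, hδ0, hδ⟩ : ∃ δ > 0, δ < min (min ε ζ.im) (min (Real.pi - ζ.im) (Real.pi / 2)) :=
      exists_between (by
        simp only [lt_min_iff]
        exact ⟨⟨hε, hζ.1⟩, by linarith [hζ.2], by linarith⟩)
    simp only [lt_min_iff] at hδ
    have := hbound s hs δ ⟨hδ0, hδ.2.2⟩ ⟨hδ.1.2.le, by linarith [hδ.2.1]⟩
    linarith [hδ.1.1]
  have h0 : (H ζ + 1).arg = 0 := by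
    have h1 := hlim 1 (by simp)
    have h2 := hlim (-1) (by simp)
    linarith
  simpa using (Complex.arg_eq_zero_iff.1 h0).2

/-- A holomorphic, real-valued function on a preconnected open set is constant. -/
lemma exists_real_const_of_im_eq_zero {H : ℂ → ℂ} {s : Set ℂ} (hs : IsOpen s)
    (hconn : IsPreconnected s) (hne : s.Nonempty) (hH : DifferentiableOn ℂ H s)
    (him : ∀ z ∈ s, (H z).im = 0) : ∃ a : ℝ, ∀ z ∈ s, H z = a := by
  rcases (hH.analyticOnNhd hs).is_constant_or_isOpen hconn with ⟨w, hw⟩ | hopen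
  · obtain ⟨z₀, hz₀⟩ := hne
    refine ⟨w.re, fun z hz => ?_⟩
    rw [hw z hz]
    apply Complex.ext <;> simp [← hw z₀ hz₀, him z₀ hz₀]
  · exfalso
    obtain ⟨z₀, hz₀⟩ := hne
    have hmem : H '' s ∈ nhds (H z₀) := (hopen s subset_rfl hs).mem_nhds ⟨z₀, hz₀, rfl⟩
    obtain ⟨ε, hε, hball⟩ := Metric.mem_nhds_iff.1 hmem
    have : H z₀ + (ε / 2 : ℝ) * I ∈ Metric.ball (H z₀) ε := by
      simp [abs_of_pos hε, hε]
    obtain ⟨z, hz, hzeq⟩ := hball this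
    have h1 := him z hz
    rw [hzeq] at h1
    simp [him z₀ hz₀] at h1
    linarith

/-- If `f` and `w ↦ -f w / w ^ 2` both map the upper half-plane to its closure, then `f` is
a real multiple of the identity there. -/
lemma exists_real_mul_of_im_nonneg {f : ℂ → ℂ}
    (hf : DifferentiableOn ℂ f {w : ℂ | 0 < w.im})
    (hf_im : ∀ w : ℂ, 0 < w.im → 0 ≤ (f w).im)
    (hg_im : ∀ w : ℂ, 0 < w.im → 0 ≤ (-f w / w ^ 2).im) :
    ∃ a : ℝ, ∀ w : ℂ, 0 < w.im → f w = a * w := by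
  have hne : ∀ w : ℂ, 0 < w.im → w ≠ 0 := fun w hw h => by simp [h] at hw
  set h : ℂ → ℂ := fun w => f w / w with hh
  have hhd : DifferentiableOn ℂ h {w : ℂ | 0 < w.im} :=
    hf.div differentiableOn_id fun w hw => hne w hw
  have hexp : ∀ ζ : ℂ, ζ.im ∈ Ioo 0 Real.pi → 0 < (cexp ζ).im := by
    intro ζ hζ
    rw [Complex.exp_im]
    exact mul_pos (Real.exp_pos _) (Real.sin_pos_of_mem_Ioo hζ)
  have hstrip : ∀ ζ : ℂ, ζ.im ∈ Ioo 0 Real.pi → (h (cexp ζ)).im = 0 := by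
    intro ζ hζ
    refine im_eq_zero_of_sector_bound (H := fun ζ => h (cexp ζ)) ?_ ?_ hζ
    · exact hhd.comp Complex.differentiable_exp.differentiableOn fun ξ hξ => hexp ξ hξ
    · intro ξ hξ
      have hw := hexp ξ hξ
      have hw0 := hne _ hw
      have hr := Real.exp_pos ξ.re
      have h1 := hf_im _ hw
      have h2 := hg_im _ hw
      have e1 : f (cexp ξ) = h (cexp ξ) * cexp ξ := by simp [hh]
      have e2 : -f (cexp ξ) / cexp ξ ^ 2 = -(h (cexp ξ) * cexp (-ξ)) := by
        rw [Complex.exp_neg, e1]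
        field_simp
      rw [e1, Complex.mul_im, Complex.exp_im, Complex.exp_re] at h1
      rw [e2, Complex.neg_im, Complex.mul_im, Complex.exp_im, Complex.exp_re, Complex.neg_im,
        Complex.neg_re, Real.sin_neg, Real.cos_neg] at h2
      have h1' : 0 ≤ Real.exp ξ.re * ((h (cexp ξ)).re * Real.sin ξ.im +
          (h (cexp ξ)).im * Real.cos ξ.im) := by linarith
      have h2' : 0 ≤ Real.exp (-ξ.re) * ((h (cexp ξ)).re * Real.sin ξ.im -
          (h (cexp ξ)).im * Real.cos ξ.im) := by linarith
      have h3 := nonneg_of_mul_nonneg_right h1' hr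
      have h4 := nonneg_of_mul_nonneg_right h2' (Real.exp_pos _)
      rw [abs_le]
      constructor <;> linarith
  have him : ∀ w ∈ {w : ℂ | 0 < w.im}, (h w).im = 0 := by
    intro w hw
    have hlog : (Complex.log w).im ∈ Ioo 0 Real.pi := by
      rw [Complex.log_im]
      refine ⟨?_, (Complex.arg_lt_pi_iff).2 (Or.inr (ne_of_gt hw))⟩
      refine lt_of_le_of_ne (Complex.arg_nonneg_iff.2 (le_of_lt hw)) fun h0 => ?_
      exact (ne_of_gt hw) (Complex.arg_eq_zero_iff.1 h0.symm).2
    have := hstrip _ hlog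
    rwa [Complex.exp_log (hne w hw)] at this
  obtain ⟨a, ha⟩ := exists_real_const_of_im_eq_zero
    (isOpen_lt continuous_const Complex.continuous_im)
    (convex_halfSpace_im_gt 0).isPreconnected ⟨I, by simp⟩ hhd him
  refine ⟨a, fun w hw => ?_⟩
  rw [← ha w hw]
  have := hne w hw
  simp [hh, this]

lemma sub_ofReal_ne_zero {z : ℂ} (hz : z.im ≠ 0) (r : ℝ) : z - r ≠ 0 := fun h => hz (by
  simpa using congrArg Complex.im h)

/-- Two nontrivial Nevanlinna functions related by `U = -((z - α) / (z - β))² V` with `β < α`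
are determined up to a positive factor. -/
lemma IsNevanlinna.exists_pos_mul_of_lt {α β : ℝ} (hαβ : β < α) {U V : ℂ → ℂ}
    (hU : IsNevanlinna U) (hV : IsNevanlinna V) (hU0 : ∃ z : ℂ, z.im ≠ 0 ∧ U z ≠ 0)
    (hrel : ∀ z : ℂ, z.im ≠ 0 →
      U z = -(((z - (α : ℂ)) ^ 2 / (z - (β : ℂ)) ^ 2) * V z)) :
    ∃ a : ℝ, 0 < a ∧ ∀ z : ℂ, z.im ≠ 0 → U z = a * ((z - α) / (z - β)) := by
  set T : ℂ → ℂ := fun w => (β * w - α) / (w - 1) with hT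
  have hw1 : ∀ w : ℂ, 0 < w.im → w - 1 ≠ 0 := fun w hw => by
    simpa using sub_ofReal_ne_zero hw.ne' 1
  have hαβ' : (α : ℂ) - β ≠ 0 := sub_ne_zero.2 (by exact_mod_cast hαβ.ne')
  have hTim : ∀ w : ℂ, 0 < w.im → 0 < (T w).im := by
    intro w hw
    have hTw : T w = β + ((β - α : ℝ) : ℂ) * (w - 1)⁻¹ := by
      have := hw1 w hw
      simp only [hT]
      push_cast
      field_simp
      ring
    rw [hTw]
    have hn := Complex.normSq_pos.2 (hw1 w hw)
    rw [Complex.add_im, Complex.ofReal_im, Complex.im_ofReal_mul, Complex.inv_im]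
    simp only [Complex.sub_im, Complex.one_im, sub_zero, zero_add]
    rw [neg_div, mul_neg, ← neg_mul]
    exact mul_pos (by linarith) (div_pos hw hn)
  have hTinv : ∀ w : ℂ, 0 < w.im → (T w - α) / (T w - β) = w := by
    intro w hw
    have h1 := hw1 w hw
    have e1 : T w - α = (β - α) * w / (w - 1) := by
      simp only [hT]; field_simp; ring
    have e2 : T w - β = (β - α) / (w - 1) := by
      simp only [hT]; field_simp; ring
    have h2 : (β : ℂ) - α ≠ 0 := fun h => hαβ' (by linear_combination -h)
    rw [e1, e2]
    field_simp
  have hUT : DifferentiableOn ℂ (fun w => U (T w)) {w : ℂ | 0 < w.im} := by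
    refine hU.holo.comp ?_ fun w hw => (hTim w hw).ne'
    refine DifferentiableOn.div (by fun_prop) (by fun_prop) fun w hw => hw1 w hw
  obtain ⟨a, ha⟩ := exists_real_mul_of_im_nonneg hUT (fun w hw => hU.im_nonneg _ (hTim w hw))
    fun w hw => by
      have hw0 : w ≠ 0 := by simpa using sub_ofReal_ne_zero hw.ne' 0
      have := hrel (T w) (hTim w hw).ne'
      rw [← div_pow, hTinv w hw] at this
      rw [this, neg_neg, mul_div_cancel_left₀ _ (pow_ne_zero 2 hw0)]
      exact hV.im_nonneg _ (hTim w hw)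
  have hupper : ∀ z : ℂ, 0 < z.im → U z = a * ((z - α) / (z - β)) := by
    intro z hz
    have hzβ := sub_ofReal_ne_zero hz.ne' β
    have hwim : 0 < ((z - α) / (z - β)).im := by
      have e : (z - α) / (z - β) = 1 + ((β - α : ℝ) : ℂ) * (z - β)⁻¹ := by
        push_cast
        field_simp
        ring
      rw [e, Complex.add_im, Complex.one_im, Complex.im_ofReal_mul, Complex.inv_im]
      simp only [Complex.sub_im, Complex.ofReal_im, sub_zero, zero_add]
      rw [neg_div, mul_neg, ← neg_mul]
      exact mul_pos (by linarith) (div_pos hz (Complex.normSq_pos.2 hzβ))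
    have hTz : T ((z - α) / (z - β)) = z := by
      have e1 : (z - α) / (z - β) - 1 = (β - α) / (z - β) := by field_simp; ring
      have e2 : β * ((z - α) / (z - β)) - α = z * ((β - α) / (z - β)) := by field_simp; ring
      have h2 : (β : ℂ) - α ≠ 0 := fun h => hαβ' (by linear_combination -h)
      simp only [hT]
      rw [e1, e2, mul_div_cancel_right₀ _ (div_ne_zero h2 hzβ)]
    have := ha _ hwim
    simpa only [hTz] using this
  have hall : ∀ z : ℂ, z.im ≠ 0 → U z = a * ((z - α) / (z - β)) := by
    intro z hz
    rcases lt_or_gt_of_ne hz with h | h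
    · have h1 := hU.symm z hz
      rw [hupper _ (by simpa using h)] at h1
      simpa using (congrArg (starRingEnd ℂ) h1).symm
    · exact hupper z h
  refine ⟨a, lt_of_le_of_ne ?_ ?_, hall⟩
  · have h1 := hU.im_nonneg _ (hTim I (by simp))
    rw [ha I (by simp)] at h1
    simpa using h1
  · rintro rfl
    obtain ⟨z, hz, hz0⟩ := hU0
    exact hz0 (by simpa using hall z hz)

/-- If `U`, `V` are nontrivial Nevanlinna functions satisfying
`U(z) = −((z−α)²/(z−β)²)·V(z)` on `ℂ∖ℝ` with `α, β ∈ ℝ`, `α ≠ β`, then there is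
`c ∈ ℝ` with `c(β−α) < 0` such that `U(z) = c(1 − (β−α)/(β−z))` and
`V(z) = c(−1 + (α−β)/(α−z))`. -/
theorem statement16 (α β : ℝ) (hαβ : α ≠ β) (U V : ℂ → ℂ)
    (hU : IsNevanlinna U) (hV : IsNevanlinna V)
    (hU0 : ∃ z : ℂ, z.im ≠ 0 ∧ U z ≠ 0) (hV0 : ∃ z : ℂ, z.im ≠ 0 ∧ V z ≠ 0)
    (hrel : ∀ z : ℂ, z.im ≠ 0 →
      U z = -(((z - (α : ℂ)) ^ 2 / (z - (β : ℂ)) ^ 2) * V z)) :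
    ∃ c : ℝ, c * (β - α) < 0 ∧ ∀ z : ℂ, z.im ≠ 0 →
      U z = (c : ℂ) * (1 - ((β : ℂ) - (α : ℂ)) / ((β : ℂ) - z)) ∧
      V z = (c : ℂ) * (-1 + ((α : ℂ) - (β : ℂ)) / ((α : ℂ) - z)) := by
  rcases lt_or_gt_of_ne hαβ with h | h
  · obtain ⟨a, ha, hVa⟩ := hV.exists_pos_mul_of_lt h hU hV0 fun z hz => by
      have h1 := sub_ofReal_ne_zero hz α
      have h2 := sub_ofReal_ne_zero hz β
      rw [hrel z hz]
      field_simp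
    refine ⟨-a, by nlinarith, fun z hz => ?_⟩
    have h1 := sub_ofReal_ne_zero hz α
    have h2 := sub_ofReal_ne_zero hz β
    have h1' : (α : ℂ) - z ≠ 0 := fun h => h1 (by linear_combination -h)
    have h2' : (β : ℂ) - z ≠ 0 := fun h => h2 (by linear_combination -h)
    rw [hrel z hz, hVa z hz]
    push_cast
    constructor <;> field_simp <;> ring
  · obtain ⟨a, ha, hUa⟩ := hU.exists_pos_mul_of_lt h hV hU0 hrel
    refine ⟨a, by nlinarith, fun z hz => ?_⟩
    have h1 := sub_ofReal_ne_zero hz α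
    have h2 := sub_ofReal_ne_zero hz β
    have h1' : (α : ℂ) - z ≠ 0 := fun h => h1 (by linear_combination -h)
    have h2' : (β : ℂ) - z ≠ 0 := fun h => h2 (by linear_combination -h)
    have hVz : V z = -((z - β) ^ 2 / (z - α) ^ 2 * U z) := by
      rw [hrel z hz]
      field_simp
    rw [hVz, hUa z hz]
    constructor <;> field_simp <;> ring
end

section
/- Let β ∈ ℝ. Suppose U and V are Nevanlinna functions, neither identically zero, satisfying U(z) = −V(z)/(z−β)² for all z ∈ ℂ∖ℝ. Then there exists d > 0 such that U(z) = d/(β−z) and V(z) = d·(z−β) for all z ∈ ℂ∖ℝ. -/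
open Complex Filter Set

/-- If `L` is holomorphic on the strip `0 < Im w < π` and `Im L` is bounded above by the distance
to the boundary of the strip, then `Im L ≤ 0`. -/
theorem im_nonpos_of_im_le_on_strip {L : ℂ → ℂ}
    (hL : DifferentiableOn ℂ L (im ⁻¹' Ioo 0 Real.pi))
    (h₁ : ∀ w : ℂ, w.im ∈ Ioo 0 Real.pi → (L w).im ≤ w.im)
    (h₂ : ∀ w : ℂ, w.im ∈ Ioo 0 Real.pi → (L w).im ≤ Real.pi - w.im)
    {w : ℂ} (hw : w.im ∈ Ioo 0 Real.pi) : (L w).im ≤ 0 := by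
  have hnorm (u : ℂ) : ‖cexp (-I * L u)‖ = Real.exp (L u).im := by
    rw [norm_exp]; simp
  refine le_of_forall_gt_imp_ge_of_dense fun η hη => ?_
  obtain ⟨ε, hε₀, hε⟩ : ∃ ε, 0 < ε ∧ ε < min η (min w.im (Real.pi - w.im)) :=
    exists_between (lt_min hη (lt_min hw.1 (sub_pos.2 hw.2)))
  obtain ⟨hεη, hε₁, hε₂⟩ : ε < η ∧ ε < w.im ∧ ε < Real.pi - w.im := by
    simpa only [lt_min_iff] using hε
  have hcl : closure (im ⁻¹' Ioo ε (Real.pi - ε)) ⊆ im ⁻¹' Ioo 0 Real.pi := by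
    refine (closure_minimal (preimage_mono Ioo_subset_Icc_self)
      (isClosed_Icc.preimage continuous_im)).trans (preimage_mono fun x hx => ?_)
    exact ⟨by linarith [hx.1], by linarith [hx.2]⟩
  have hd : DiffContOnCl ℂ (fun u => cexp (-I * L u)) (im ⁻¹' Ioo ε (Real.pi - ε)) :=
    DifferentiableOn.diffContOnCl ((hL.mono hcl).const_mul (-I)).cexp
  have key : ‖cexp (-I * L w)‖ ≤ Real.exp ε := by
    refine PhragmenLindelof.horizontal_strip (f := fun u => cexp (-I * L u)) hd
      ⟨0, ?_, 0, ?_⟩ (fun u hu => ?_) (fun u hu => ?_)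
      hε₁.le (by linarith)
    · exact div_pos Real.pi_pos (by linarith)
    · refine Asymptotics.IsBigO.of_bound (Real.exp Real.pi) ?_
      refine Eventually.filter_mono inf_le_right (eventually_principal.2 fun u hu => ?_)
      have hu' := hcl (subset_closure hu)
      rw [hnorm]
      simpa using (h₁ u hu').trans hu'.2.le
    · rw [hnorm, Real.exp_le_exp, ← hu]
      exact h₁ u ⟨by linarith, by linarith⟩
    · rw [hnorm, Real.exp_le_exp]
      linarith [h₂ u ⟨by linarith, by linarith⟩]
  rw [hnorm, Real.exp_le_exp] at key
  linarith

/-- A point of the right half-plane whose slope is at most `tan θ` has argument at most `θ`. -/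
theorem abs_arg_le_of_abs_im_mul_cos_le {x : ℂ} {θ : ℝ} (hx : 0 < x.re) (hθ : 0 < θ)
    (h : |x.im * Real.cos θ| ≤ x.re * Real.sin θ) : |arg x| ≤ θ := by
  obtain ⟨hl, hr⟩ := abs_lt.1 (abs_arg_lt_pi_div_two_iff.2 (Or.inl hx))
  obtain ⟨h₁, h₂⟩ := abs_le.1 h
  have hpos : 0 < ‖x‖ := norm_pos_iff.2 fun h0 => by simp [h0] at hx
  have hcos := norm_mul_cos_arg x
  have hsin := norm_mul_sin_arg x
  rw [abs_le]
  constructor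
  · by_contra! hlt
    have := mul_pos hpos (Real.sin_pos_of_pos_of_lt_pi (x := -arg x - θ) (by linarith)
      (by linarith [Real.pi_pos]))
    rw [Real.sin_sub, Real.sin_neg, Real.cos_neg] at this
    rw [← hcos, ← hsin] at h₁
    linarith
  · by_contra! hlt
    have := mul_pos hpos (Real.sin_pos_of_pos_of_lt_pi (x := arg x - θ) (by linarith)
      (by linarith [Real.pi_pos]))
    rw [Real.sin_sub] at this
    rw [← hcos, ← hsin] at h₂
    linarith

/-- A holomorphic function on the strip `0 < Im w < π` with values of nonnegative real part and
with slope at most `|tan (Im w)|` is real-valued. -/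
theorem im_eq_zero_of_slope_le_on_strip {G : ℂ → ℂ}
    (hG : DifferentiableOn ℂ G (im ⁻¹' Ioo 0 Real.pi))
    (hre : ∀ w : ℂ, w.im ∈ Ioo 0 Real.pi → 0 ≤ (G w).re)
    (hslope : ∀ w : ℂ, w.im ∈ Ioo 0 Real.pi →
      |(G w).im * Real.cos w.im| ≤ (G w).re * Real.sin w.im)
    {w : ℂ} (hw : w.im ∈ Ioo 0 Real.pi) : (G w).im = 0 := by
  have hre' (u : ℂ) (hu : u.im ∈ Ioo 0 Real.pi) : 0 < (G u + 1).re := by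
    have := hre u hu
    simp only [add_re, one_re]; linarith
  have hslope' (u : ℂ) (hu : u.im ∈ Ioo 0 Real.pi) :
      |(G u + 1).im * Real.cos u.im| ≤ (G u + 1).re * Real.sin u.im := by
    have := hslope u hu
    have := Real.sin_pos_of_pos_of_lt_pi hu.1 hu.2
    simp only [add_re, one_re, add_im, one_im, add_zero]; linarith
  have hd : DifferentiableOn ℂ (fun u => log (G u + 1)) (im ⁻¹' Ioo 0 Real.pi) :=
    (hG.add_const 1).clog fun u hu => Or.inl (hre' u hu)
  have hb₁ (u : ℂ) (hu : u.im ∈ Ioo 0 Real.pi) : |arg (G u + 1)| ≤ u.im :=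
    abs_arg_le_of_abs_im_mul_cos_le (hre' u hu) hu.1 (hslope' u hu)
  have hb₂ (u : ℂ) (hu : u.im ∈ Ioo 0 Real.pi) : |arg (G u + 1)| ≤ Real.pi - u.im :=
    abs_arg_le_of_abs_im_mul_cos_le (hre' u hu) (sub_pos.2 hu.2)
      (by simpa using hslope' u hu)
  have hle : arg (G w + 1) ≤ 0 := by
    simpa only [log_im] using im_nonpos_of_im_le_on_strip hd
      (fun u hu => by simpa only [log_im] using (le_abs_self _).trans (hb₁ u hu))
      (fun u hu => by simpa only [log_im] using (le_abs_self _).trans (hb₂ u hu)) hw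
  have hge : -arg (G w + 1) ≤ 0 := by
    simpa only [log_im, neg_im] using im_nonpos_of_im_le_on_strip (L := fun u => -log (G u + 1))
      hd.fun_neg
      (fun u hu => by simpa only [neg_im, log_im] using (neg_le_abs _).trans (hb₁ u hu))
      (fun u hu => by simpa only [neg_im, log_im] using (neg_le_abs _).trans (hb₂ u hu)) hw
  have h0 : arg (G w + 1) = 0 := by linarith
  simpa using (arg_eq_zero_iff.1 h0).2

/-- A holomorphic function on the upper half-plane with values of nonnegative real part and with
slope at most `Im z / |Re z - β|` is a nonnegative real constant. -/
theorem exists_eq_const_of_slope_le {F : ℂ → ℂ} (β : ℝ)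
    (hF : DifferentiableOn ℂ F {z : ℂ | 0 < z.im})
    (hre : ∀ z : ℂ, 0 < z.im → 0 ≤ (F z).re)
    (hslope : ∀ z : ℂ, 0 < z.im → |(F z).im * (z.re - β)| ≤ (F z).re * z.im) :
    ∃ d : ℝ, 0 ≤ d ∧ ∀ z : ℂ, 0 < z.im → F z = d := by
  have hopen : IsOpen {z : ℂ | 0 < z.im} := isOpen_lt continuous_const continuous_im
  have hpos (w : ℂ) (hw : w.im ∈ Ioo 0 Real.pi) : 0 < (β + cexp w).im := by
    have := mul_pos (Real.exp_pos w.re) (Real.sin_pos_of_pos_of_lt_pi hw.1 hw.2)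
    simpa [exp_im] using this
  have hreal (z : ℂ) (hz : 0 < z.im) : (F z).im = 0 := by
    have hzβ : z - β ≠ 0 := fun h => hz.ne' (by simpa using congrArg im h)
    have harg : (log (z - β)).im ∈ Ioo 0 Real.pi := by
      have him : 0 < (z - β).im := by simpa using hz
      rw [log_im]
      refine ⟨(arg_nonneg_iff.2 him.le).lt_of_ne' fun h => ?_, (arg_le_pi _).lt_of_ne fun h => ?_⟩
      · exact him.ne' (arg_eq_zero_iff.1 h).2
      · exact him.ne' (arg_eq_pi_iff.1 h).2
    have := im_eq_zero_of_slope_le_on_strip (G := fun w => F (β + cexp w))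
      (hF.comp (differentiable_exp.const_add (β : ℂ)).differentiableOn hpos)
      (fun w hw => hre _ (hpos w hw)) (fun w hw => ?_) harg
    · simpa [exp_log hzβ] using this
    · have h := hslope _ (hpos w hw)
      simp only [add_re, ofReal_re, add_im, ofReal_im, zero_add, add_sub_cancel_left, exp_re,
        exp_im, mul_left_comm _ (Real.exp w.re)] at h
      rw [abs_mul, abs_of_pos (Real.exp_pos _)] at h
      exact le_of_mul_le_mul_left h (Real.exp_pos _)
  obtain ⟨c, hc⟩ := (hF.analyticOnNhd hopen).eq_const_of_im_eq_const hreal hopen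
    ((convex_halfSpace_im_gt 0).isConnected ⟨I, by simp⟩)
  have hI : (0 : ℝ) < I.im := by simp
  refine ⟨(F I).re, hre I hI, fun z hz => ?_⟩
  rw [hc z hz, ← hc I hI]
  exact Complex.ext (by simp) (by simpa using hreal I hI)

/-- If `U`, `V` are nontrivial Nevanlinna functions satisfying
`U(z) = −V(z)/(z−β)²` on `ℂ∖ℝ` with `β ∈ ℝ`, then there is `d > 0` such that
`U(z) = d/(β−z)` and `V(z) = d(z−β)`. -/
theorem statement17 (β : ℝ) (U V : ℂ → ℂ)
    (hU : IsNevanlinna U) (hV : IsNevanlinna V)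
    (hU0 : ∃ z : ℂ, z.im ≠ 0 ∧ U z ≠ 0) (hV0 : ∃ z : ℂ, z.im ≠ 0 ∧ V z ≠ 0)
    (hrel : ∀ z : ℂ, z.im ≠ 0 → U z = -(V z / (z - (β : ℂ)) ^ 2)) :
    ∃ d : ℝ, 0 < d ∧ ∀ z : ℂ, z.im ≠ 0 →
      U z = (d : ℂ) / ((β : ℂ) - z) ∧ V z = (d : ℂ) * (z - (β : ℂ)) := by
  have hne (z : ℂ) (hz : z.im ≠ 0) : z - β ≠ 0 := fun h => hz (by simpa using congrArg im h)
  have hslope (z : ℂ) (hz : 0 < z.im) :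
      |(V z / (z - β)).im * (z.re - β)| ≤ (V z / (z - β)).re * z.im := by
    have hz0 := hne z hz.ne'
    set f := V z / (z - β) with hf
    have hVf : V z = f * (z - β) := by rw [hf]; field_simp
    have hUf : U z = ((normSq (z - β))⁻¹ : ℝ) * -(f * (starRingEnd ℂ) (z - β)) := by
      rw [hrel z hz.ne', hVf, ofReal_inv, normSq_eq_conj_mul_self]
      have := (map_ne_zero (starRingEnd ℂ)).2 hz0
      field_simp
    have h₁ := hV.im_nonneg z hz
    have h₂ := hU.im_nonneg z hz
    rw [hUf, im_ofReal_mul] at h₂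
    have h₃ := nonneg_of_mul_nonneg_right h₂ (inv_pos.2 (normSq_pos.2 hz0))
    rw [hVf] at h₁
    simp at h₁ h₃
    rw [abs_le]
    constructor <;> linarith
  have hre (z : ℂ) (hz : 0 < z.im) : 0 ≤ (V z / (z - β)).re :=
    nonneg_of_mul_nonneg_left ((abs_nonneg _).trans (hslope z hz)) hz
  obtain ⟨d, hd, hconst⟩ := exists_eq_const_of_slope_le (F := fun z => V z / (z - β)) β
    ((hV.holo.mono fun z hz => ne_of_gt hz).div (by fun_prop) fun z hz => hne z (ne_of_gt hz))
    hre hslope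
  have hupper (z : ℂ) (hz : 0 < z.im) : V z = d * (z - β) :=
    (div_eq_iff (hne z hz.ne')).1 (hconst z hz)
  have hall (z : ℂ) (hz : z.im ≠ 0) : V z = d * (z - β) := by
    rcases hz.lt_or_gt with h | h
    · have hc := hupper ((starRingEnd ℂ) z) (by simpa using h)
      rw [hV.symm z hz] at hc
      simpa using congrArg (starRingEnd ℂ) hc
    · exact hupper z h
  obtain ⟨z₀, hz₀, hVz₀⟩ := hV0
  refine ⟨d, hd.lt_of_ne fun h => hVz₀ (by simp [hall z₀ hz₀, ← h]), fun z hz => ⟨?_, hall z hz⟩⟩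
  have h₁ := hne z hz
  have h₂ : (β : ℂ) - z ≠ 0 := by rw [← neg_sub]; exact neg_ne_zero.2 h₁
  rw [hrel z hz, hall z hz]
  field_simp
  ring
end

section
/- Let α ∈ ℝ. Suppose U and V are Nevanlinna functions, neither identically zero, satisfying U(z) = −(z−α)²·V(z) for all z ∈ ℂ∖ℝ. Then there exists e > 0 such that U(z) = e·(z−α) and V(z) = e/(α−z) for all z ∈ ℂ∖ℝ. -/
open Complex Filter Set

/-- A bounded holomorphic function on the strip `0 < im z < π` whose imaginary part is at most
`sin ε / cos ε` on the lines `im z = ε` and `im z = π - ε` has nonpositive imaginary part. -/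
lemma im_nonpos_of_strip_bound {Q : ℂ → ℂ}
    (hd : DifferentiableOn ℂ Q (im ⁻¹' Ioo 0 Real.pi))
    (hb : ∀ z, 0 < z.im → z.im < Real.pi → (Q z).im ≤ 1)
    (hε : ∀ ε : ℝ, 0 < ε → ε < Real.pi / 2 → ∀ z : ℂ, (z.im = ε ∨ z.im = Real.pi - ε) →
      (Q z).im ≤ Real.sin ε / Real.cos ε)
    {z : ℂ} (hz0 : 0 < z.im) (hzπ : z.im < Real.pi) : (Q z).im ≤ 0 := by
  have hnorm (w : ℂ) : ‖Complex.exp (-I * Q w)‖ = Real.exp (Q w).im := by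
    rw [Complex.norm_exp]
    simp
  have key : ∀ᶠ ε : ℝ in nhdsWithin 0 (Ioi 0), (Q z).im ≤ Real.sin ε / Real.cos ε := by
    have hpos : 0 < min (min z.im (Real.pi - z.im)) (Real.pi / 2) :=
      lt_min (lt_min hz0 (sub_pos.2 hzπ)) (by positivity)
    filter_upwards [Ioo_mem_nhdsGT hpos] with ε hεI
    obtain ⟨hε0, hεlt⟩ := hεI
    obtain ⟨h12, hεπ⟩ := lt_min_iff.1 hεlt
    obtain ⟨h1, h2⟩ := lt_min_iff.1 h12
    have hsub : closure (im ⁻¹' Ioo ε (Real.pi - ε)) ⊆ im ⁻¹' Ioo 0 Real.pi := by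
      refine (closure_minimal (t := im ⁻¹' Icc ε (Real.pi - ε))
        (preimage_mono Ioo_subset_Icc_self) (isClosed_Icc.preimage continuous_im)).trans ?_
      exact preimage_mono fun x hx => ⟨by linarith [hx.1], by linarith [hx.2]⟩
    have hF : DiffContOnCl ℂ (fun w => Complex.exp (-I * Q w)) (im ⁻¹' Ioo ε (Real.pi - ε)) :=
      ((hd.mono hsub).const_mul (-I)).cexp.diffContOnCl
    have := PhragmenLindelof.horizontal_strip (C := Real.exp (Real.sin ε / Real.cos ε)) hF
      ⟨0, div_pos Real.pi_pos (by linarith), 0, ?_⟩ ?_ ?_ (z := z) h1.le (by linarith)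
    · rwa [hnorm, Real.exp_le_exp] at this
    · refine Asymptotics.IsBigO.of_bound (Real.exp 1) ?_
      refine eventually_inf_principal.2 (Eventually.of_forall fun w hw => ?_)
      rw [hnorm]
      simpa using hb w (hε0.trans hw.1) (by linarith [hw.2])
    · intro w hw
      rw [hnorm, Real.exp_le_exp]
      exact hε ε hε0 hεπ w (Or.inl hw)
    · intro w hw
      rw [hnorm, Real.exp_le_exp]
      exact hε ε hε0 hεπ w (Or.inr hw)
  have hlim : Tendsto (fun ε : ℝ => Real.sin ε / Real.cos ε) (nhdsWithin 0 (Ioi 0)) (nhds 0) := by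
    have : ContinuousAt (fun ε : ℝ => Real.sin ε / Real.cos ε) 0 :=
      Real.continuous_sin.continuousAt.div Real.continuous_cos.continuousAt (by simp)
    simpa [ContinuousAt] using this.tendsto.mono_left nhdsWithin_le_nhds
  exact ge_of_tendsto hlim key

/-- The imaginary part of the Cayley transform `(w - 1) / (w + 1)`. -/
lemma im_cayley (w : ℂ) : ((w - 1) / (w + 1)).im = 2 * w.im / normSq (w + 1) := by
  rw [Complex.div_im]
  simp
  ring

/-- In the right half-plane the Cayley transform contracts sectors around the real axis. -/
lemma abs_im_cayley_le {w : ℂ} {t : ℝ} (hre : 0 ≤ w.re) (ht : 0 ≤ t) (h : |w.im| ≤ t * w.re) :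
    |((w - 1) / (w + 1)).im| ≤ t := by
  have hpos : 0 < normSq (w + 1) := by
    rw [normSq_apply]
    simp
    nlinarith [mul_self_nonneg w.im]
  rw [im_cayley, abs_div, abs_mul, abs_of_pos hpos, div_le_iff₀ hpos, normSq_apply]
  simp
  nlinarith [mul_nonneg ht (mul_self_nonneg w.im), mul_nonneg ht (mul_self_nonneg w.re)]

/-- In the closed right half-plane the Cayley transform has imaginary part at most one. -/
lemma abs_im_cayley_le_one {w : ℂ} (hre : 0 ≤ w.re) : |((w - 1) / (w + 1)).im| ≤ 1 := by
  have hpos : 0 < normSq (w + 1) := by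
    rw [normSq_apply]
    simp
    nlinarith [mul_self_nonneg w.im]
  rw [im_cayley, abs_div, abs_mul, abs_of_pos hpos, div_le_iff₀ hpos, normSq_apply]
  simp
  nlinarith [sq_abs w.im, sq_nonneg (|w.im| - 1)]

/-- A holomorphic function on the upper half-plane with `|re z * im W z| ≤ im z * re W z`
is real-valued there. -/
lemma im_eq_zero_of_sector_bound_s18 {W : ℂ → ℂ} (hd : DifferentiableOn ℂ W {z | 0 < z.im})
    (hW : ∀ z : ℂ, 0 < z.im → |z.re * (W z).im| ≤ z.im * (W z).re) {z : ℂ} (hz : 0 < z.im) :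
    (W z).im = 0 := by
  have hre (z : ℂ) (hz : 0 < z.im) : 0 ≤ (W z).re :=
    nonneg_of_mul_nonneg_right ((abs_nonneg _).trans (hW z hz)) hz
  have hne (z : ℂ) (hz : 0 < z.im) : W z + 1 ≠ 0 := fun h => by
    have := congrArg re h
    simp at this
    linarith [hre z hz]
  have hexp (s : ℂ) (h0 : 0 < s.im) (hπ : s.im < Real.pi) : 0 < (Complex.exp s).im := by
    rw [exp_im]
    exact mul_pos (Real.exp_pos _) (Real.sin_pos_of_pos_of_lt_pi h0 hπ)
  set Q : ℂ → ℂ := fun s => (W (Complex.exp s) - 1) / (W (Complex.exp s) + 1) with hQ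
  have hWd : DifferentiableOn ℂ (fun s => W (Complex.exp s)) (im ⁻¹' Ioo 0 Real.pi) :=
    hd.comp differentiable_exp.differentiableOn fun s hs => hexp s hs.1 hs.2
  have hQd : DifferentiableOn ℂ Q (im ⁻¹' Ioo 0 Real.pi) :=
    (hWd.sub_const 1).div (hWd.add_const 1) fun s hs => hne _ (hexp s hs.1 hs.2)
  have hQ1 (s : ℂ) (h0 : 0 < s.im) (hπ : s.im < Real.pi) : |(Q s).im| ≤ 1 :=
    abs_im_cayley_le_one (hre _ (hexp s h0 hπ))
  have hQε (ε : ℝ) (h0 : 0 < ε) (hε : ε < Real.pi / 2) (s : ℂ)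
      (hs : s.im = ε ∨ s.im = Real.pi - ε) : |(Q s).im| ≤ Real.sin ε / Real.cos ε := by
    have hcos : 0 < Real.cos ε := Real.cos_pos_of_mem_Ioo ⟨by linarith, hε⟩
    have hsin : 0 < Real.sin ε := Real.sin_pos_of_pos_of_lt_pi h0 (by linarith)
    have hpos : 0 < (Complex.exp s).im := hexp s (by rcases hs with h | h <;> linarith)
      (by rcases hs with h | h <;> linarith)
    refine abs_im_cayley_le (hre _ hpos) (by positivity) ?_
    have h := hW _ hpos
    have hc : |Real.cos s.im| = Real.cos ε := by
      rcases hs with h | h <;> simp [h, Real.cos_pi_sub, abs_of_pos hcos]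
    have hs' : Real.sin s.im = Real.sin ε := by
      rcases hs with h | h <;> simp [h, Real.sin_pi_sub]
    rw [abs_mul, exp_re, exp_im, abs_mul, hc, hs', abs_of_pos (Real.exp_pos _), mul_assoc,
      mul_assoc, mul_le_mul_iff_right₀ (Real.exp_pos _)] at h
    rw [div_mul_eq_mul_div, le_div_iff₀ hcos]
    linarith
  have hz0 : z ≠ 0 := by
    rintro rfl
    simp at hz
  have hl0 : 0 < (log z).im := by
    rw [log_im]
    refine lt_of_le_of_ne (arg_nonneg_iff.2 hz.le) fun h => ?_
    exact hz.ne (arg_eq_zero_iff.1 h.symm).2.symm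
  have hlπ : (log z).im < Real.pi := by
    rw [log_im]
    refine lt_of_le_of_ne (arg_le_pi z) fun h => ?_
    exact hz.ne (arg_eq_pi_iff.1 h).2.symm
  have hle : (Q (log z)).im ≤ 0 := im_nonpos_of_strip_bound hQd
    (fun s h0 hπ => (le_abs_self _).trans (hQ1 s h0 hπ))
    (fun ε h0 hε s hs => (le_abs_self _).trans (hQε ε h0 hε s hs)) hl0 hlπ
  have hge : (-Q (log z)).im ≤ 0 := im_nonpos_of_strip_bound (Q := fun s => -Q s) hQd.neg
    (fun s h0 hπ => (neg_le_abs _).trans (hQ1 s h0 hπ))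
    (fun ε h0 hε s hs => (neg_le_abs _).trans (hQε ε h0 hε s hs)) hl0 hlπ
  have h0 : (Q (log z)).im = 0 := le_antisymm hle (by simpa using hge)
  rw [hQ] at h0
  simp only [exp_log hz0] at h0
  rw [im_cayley, div_eq_zero_iff] at h0
  rcases h0 with h | h
  · linarith
  · exact absurd (normSq_eq_zero.1 h) (hne z hz)

/-- If `U`, `V` are nontrivial Nevanlinna functions satisfying
`U(z) = −(z−α)²·V(z)` on `ℂ∖ℝ` with `α ∈ ℝ`, then there is `e > 0` such that
`U(z) = e(z−α)` and `V(z) = e/(α−z)`. -/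
theorem statement18 (α : ℝ) (U V : ℂ → ℂ)
    (hU : IsNevanlinna U) (hV : IsNevanlinna V)
    (hU0 : ∃ z : ℂ, z.im ≠ 0 ∧ U z ≠ 0) (hV0 : ∃ z : ℂ, z.im ≠ 0 ∧ V z ≠ 0)
    (hrel : ∀ z : ℂ, z.im ≠ 0 → U z = -((z - (α : ℂ)) ^ 2 * V z)) :
    ∃ e : ℝ, 0 < e ∧ ∀ z : ℂ, z.im ≠ 0 →
      U z = (e : ℂ) * (z - (α : ℂ)) ∧ V z = (e : ℂ) / ((α : ℂ) - z) := by
  have hne (z : ℂ) (hz : z.im ≠ 0) : z ≠ 0 := by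
    rintro rfl
    simp at hz
  set W : ℂ → ℂ := fun z => U (z + α) / z with hWdef
  have hUW (z : ℂ) (hz : z.im ≠ 0) : U (z + α) = z * W z := by
    rw [hWdef]
    field_simp [hne z hz]
  have hVW (z : ℂ) (hz : z.im ≠ 0) : normSq z * V (z + α) = -(W z * (starRingEnd ℂ) z) := by
    have h1 := hrel (z + α) (by simpa using hz)
    rw [hUW z hz, add_sub_cancel_right] at h1
    have h2 : W z = -(z * V (z + α)) := by
      apply mul_left_cancel₀ (hne z hz)
      rw [h1]
      ring
    rw [h2, ← mul_conj]
    ring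
  have hd : DifferentiableOn ℂ W {z | 0 < z.im} := by
    refine DifferentiableOn.div ?_ differentiableOn_id fun z hz => hne z (ne_of_gt hz)
    refine hU.holo.comp (differentiable_id.add_const (α : ℂ)).differentiableOn fun z hz => ?_
    simpa using ne_of_gt hz
  have hsector (z : ℂ) (hz : 0 < z.im) : |z.re * (W z).im| ≤ z.im * (W z).re := by
    have h1 := hU.im_nonneg (z + α) (by simpa using hz)
    have h2 := mul_nonneg (normSq_nonneg z) (hV.im_nonneg (z + α) (by simpa using hz))
    rw [hUW z hz.ne'] at h1
    rw [← im_ofReal_mul, hVW z hz.ne'] at h2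
    simp at h1 h2
    rw [abs_le]
    constructor <;> linarith
  obtain ⟨e, he⟩ : ∃ e : ℝ, ∀ z : ℂ, 0 < z.im → W z = e := by
    simpa using (hd.analyticOnNhd (isOpen_im_gt 0)).eq_const_add_im_mul_I_of_re_eq_const
      (c₀ := 0) (fun z hz => im_eq_zero_of_sector_bound_s18 hd hsector hz) (isOpen_im_gt 0)
      ((convex_halfSpace_im_gt 0).isConnected ⟨I, by simp⟩)
  have hup (z : ℂ) (hz : 0 < z.im) : U z = e * (z - α) := by
    have h0 : 0 < (z - α).im := by simpa using hz
    have h := hUW (z - α) h0.ne'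
    rwa [sub_add_cancel, he _ h0, mul_comm] at h
  have hall (z : ℂ) (hz : z.im ≠ 0) : U z = e * (z - α) := by
    rcases hz.lt_or_gt with h | h
    · have h1 := hU.symm _ (show ((starRingEnd ℂ) z).im ≠ 0 by simpa using hz)
      rw [conj_conj, hup ((starRingEnd ℂ) z) (by simpa using h)] at h1
      simpa using h1
    · exact hup z h
  have he0 : 0 ≤ e := by
    have h := hU.im_nonneg I (by simp)
    rw [hall I (by simp)] at h
    simpa using h
  refine ⟨e, lt_of_le_of_ne he0 ?_, fun z hz => ⟨hall z hz, ?_⟩⟩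
  · rintro rfl
    obtain ⟨z, hz, h⟩ := hU0
    exact h (by simp [hall z hz])
  · have hzα : z - α ≠ 0 := hne _ (by simpa using hz)
    have hαz : (α : ℂ) - z ≠ 0 := by
      rw [← neg_sub]
      exact neg_ne_zero.2 hzα
    rw [eq_div_iff hαz]
    apply mul_left_cancel₀ hzα
    have h := hrel z hz
    rw [hall z hz] at h
    linear_combination -h
end
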